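/- arXiv:1408.6968 — 3 statements merged into one kernel-verified Lean document; each statement's English description precedes it below -/
import Mathlib

section
/- Let F be a finite field with q elements and let E be an elliptic curve over F (a Weierstrass curve over F with nonzero discriminant). Then the number N of F-rational points of E (the cardinality of the group of points of E over F, including the point at infinity) satisfies |N - (q + 1)| ≤ 2√q. -/
namespace WeierstrassCurve.Affine.Point

open MvPolynomial

variable {K : Type*} [Field K] [DecidableEq K] {W : Affine K} [W.IsElliptic]

/-- Over a field, `addSubMap` sends `sym2x P P` to a representative of `sym2x (P + P) 0`. -/
lemma eval_addSubMap_sym2x_self (P : W.Point) :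
    ∃ c : K, c ≠ 0 ∧ ∀ i, (addSubMap W i).eval (P.sym2x P) = c * (P + P).sym2x 0 i := by
  match P with
  | 0 =>
    refine ⟨1, one_ne_zero, fun i ↦ ?_⟩
    fin_cases i <;> simp [addSubMap]
  | some x y h =>
    have heq := (W.equation_iff x y).mp h.1
    by_cases hy : y = W.negY x y
    · rw [add_self_of_Y_eq hy]
      have hne := addSubMap_ne_zero W (sym2x_ne_zero (some x y h) (some x y h))
      have h1 : (addSubMap W 1).eval ((some x y h).sym2x (some x y h)) = 0 := by
        rw [negY] at hy
        simp [addSubMap, b₂, b₄, b₆]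
        linear_combination (-4) * heq + (2 * y + W.a₁ * x + W.a₃) * hy
      have h2 : (addSubMap W 2).eval ((some x y h).sym2x (some x y h)) = 0 := by
        simp [addSubMap]
        ring
      refine ⟨(addSubMap W 0).eval ((some x y h).sym2x (some x y h)), fun h0 ↦ hne ?_,
        fun i ↦ ?_⟩
      · ext i
        fin_cases i
        exacts [h0, h1, h2]
      · fin_cases i
        · simp
        · simpa using h1
        · simpa using h2
    · obtain ⟨d, hd⟩ : ∃ d, d = y - W.negY x y := ⟨_, rfl⟩
      have hd0 : d ≠ 0 := hd ▸ sub_ne_zero.mpr hy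
      rw [add_self_of_Y_ne hy, sym2x_some_zero, slope_of_Y_ne rfl hy, ← hd]
      refine ⟨d ^ 2, pow_ne_zero 2 hd0, fun i ↦ ?_⟩
      rw [negY] at hd
      fin_cases i
      · simp [addSubMap, b₂, b₄, b₆, b₈, addX]
        field_simp
        have ha : W.a₆ = y ^ 2 + W.a₁ * x * y + W.a₃ * y - (x ^ 3 + W.a₂ * x ^ 2 + W.a₄ * x) := by
          linear_combination -heq
        rw [ha, hd]
        ring
      · simp [addSubMap, b₂, b₄, b₆, hd]
        linear_combination (-4) * heq
      · simp [addSubMap]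
        ring

lemma eval_addSubMap_sym2x (P Q : W.Point) :
    ∃ c : K, c ≠ 0 ∧
      ∀ i, (addSubMap W i).eval (P.sym2x Q) = c * (P + Q).sym2x (P - Q) i := by
  by_cases hPQ : P = Q
  · subst hPQ
    simpa using eval_addSubMap_sym2x_self P
  by_cases hPQ' : P = -Q
  · subst hPQ'
    obtain ⟨c, hc, h⟩ := eval_addSubMap_sym2x_self Q
    refine ⟨c, hc, fun i ↦ ?_⟩
    rw [sym2x_neg_left, h, neg_add_cancel, sym2x_comm, ← neg_add', sym2x_neg_right]
  match P, Q with
  | 0, 0 => simp at hPQ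
  | 0, some x y h =>
    refine ⟨1, one_ne_zero, fun i ↦ ?_⟩
    rw [zero_add, zero_sub, sym2x_neg_right]
    fin_cases i <;> simp [addSubMap, pow_two, two_mul]
  | some x y h, 0 =>
    refine ⟨1, one_ne_zero, fun i ↦ ?_⟩
    rw [add_zero, sub_zero]
    fin_cases i <;> simp [addSubMap, pow_two, two_mul]
  | some x y h, some x' y' h' =>
    have hx : x ≠ x' := fun hx ↦ (X_eq_iff (h₁ := h) (h₂ := h')).mp hx |>.elim hPQ hPQ'
    have hd : x - x' ≠ 0 := sub_ne_zero.mpr hx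
    have e := (W.equation_iff x y).mp h.1
    have e' := (W.equation_iff x' y').mp h'.1
    rw [sub_eq_add_neg, neg_some, add_of_X_ne hx, add_of_X_ne hx, sym2x_some_some,
      sym2x_some_some, slope_of_X_ne hx, slope_of_X_ne hx]
    refine ⟨(x - x') ^ 2, pow_ne_zero 2 hd, fun i ↦ ?_⟩
    fin_cases i
    · simp [addSubMap, b₂, b₄, b₆, b₈, addX, negY]
      field_simp
      grind
    · simp [addSubMap, b₂, b₄, b₆, b₈, addX, negY]
      field_simp
      grind
    · simp [addSubMap]
      ring

end WeierstrassCurve.Affine.Point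
open Polynomial

/-- The coefficients of the product of two binary linear forms. -/
def symMul {R : Type*} [CommRing R] (p r : Fin 2 → R) : Fin 3 → R :=
  ![p 0 * r 0, p 0 * r 1 + p 1 * r 0, p 1 * r 1]

lemma symMul_ne_zero {R : Type*} [CommRing R] [IsDomain R] {p r : Fin 2 → R} (hp : p ≠ 0)
    (hr : r ≠ 0) : symMul p r ≠ 0 := by
  intro h
  have h0 := congrFun h 0
  have h1 := congrFun h 1
  have h2 := congrFun h 2
  simp only [symMul, Matrix.cons_val, Pi.zero_apply] at h0 h1 h2
  have key : (p 0 = 0 ∧ p 1 = 0) ∨ (r 0 = 0 ∧ r 1 = 0) := by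
    rcases mul_eq_zero.mp h0 with h0 | h0 <;> rcases mul_eq_zero.mp h2 with h2 | h2 <;>
      simp_all
  rcases key with ⟨k0, k1⟩ | ⟨k0, k1⟩
  · exact hp (by ext i; fin_cases i; exacts [k0, k1])
  · exact hr (by ext i; fin_cases i; exacts [k0, k1])

lemma WeierstrassCurve.eval_addSubMap_map {R S : Type*} [CommRing R] [CommRing S]
    (W : WeierstrassCurve R) (f : R →+* S) (s : Fin 3 → R) (i : Fin 3) :
    (addSubMap (W.map f) i).eval (fun j ↦ f (s j)) = f ((addSubMap W i).eval s) := by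
  fin_cases i <;> simp [addSubMap, map_ofNat f]

lemma WeierstrassCurve.eval_addSubMap_mul {R : Type*} [CommRing R]
    (W : WeierstrassCurve R) (c : R) (s : Fin 3 → R) (i : Fin 3) :
    (addSubMap W i).eval (fun j ↦ c * s j) = c ^ 2 * (addSubMap W i).eval s := by
  fin_cases i <;> simp [addSubMap] <;> ring

/-- The family `s` of polynomials, seen as homogeneous coordinates, has degree `M`. -/
def HasMaxDegree {F ι : Type*} [Field F] (s : ι → F[X]) (M : ℕ) : Prop :=
  (∀ i, (s i).natDegree ≤ M) ∧ (fun i ↦ (s i).coeff M) ≠ 0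

namespace HasMaxDegree

variable {F ι : Type*} [Field F]

lemma unique {s : ι → F[X]} {M N : ℕ} (hM : HasMaxDegree s M) (hN : HasMaxDegree s N) :
    M = N := by
  obtain ⟨i, hi⟩ := Function.ne_iff.mp hM.2
  obtain ⟨j, hj⟩ := Function.ne_iff.mp hN.2
  exact le_antisymm ((le_natDegree_of_ne_zero hi).trans (hN.1 i))
    ((le_natDegree_of_ne_zero hj).trans (hM.1 j))

lemma exists_of_ne_zero [Fintype ι] {s : ι → F[X]} (hs : s ≠ 0) : ∃ M, HasMaxDegree s M := by
  obtain ⟨j, hj⟩ := Function.ne_iff.mp hs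
  have : Nonempty ι := ⟨j⟩
  obtain ⟨i, -, hi⟩ := Finset.exists_max_image Finset.univ (fun i ↦ (s i).natDegree)
    Finset.univ_nonempty
  by_cases h0 : s i = 0
  · refine ⟨0, fun k ↦ by simpa [h0] using hi k (Finset.mem_univ k), fun h ↦ hj ?_⟩
    have hd : (s j).natDegree = 0 := by simpa [h0] using hi j (Finset.mem_univ j)
    rw [eq_C_of_natDegree_eq_zero hd, show (s j).coeff 0 = 0 from congrFun h j]
    simp
  · refine ⟨(s i).natDegree, fun k ↦ hi k (Finset.mem_univ k), fun h ↦ h0 ?_⟩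
    simpa using congrFun h i

lemma symMul {p r : Fin 2 → F[X]} {M N : ℕ} (hp : HasMaxDegree p M) (hr : HasMaxDegree r N) :
    HasMaxDegree (symMul p r) (M + N) := by
  have hle (i j) : (p i * r j).natDegree ≤ M + N :=
    natDegree_mul_le_of_le (hp.1 i) (hr.1 j)
  refine ⟨fun i ↦ ?_, ?_⟩
  · fin_cases i
    · exact hle 0 0
    · exact natDegree_add_le_of_degree_le (hle 0 1) (hle 1 0)
    · exact hle 1 1
  · convert symMul_ne_zero hp.2 hr.2 using 1
    ext i
    have hc (i j) := coeff_mul_add_eq_of_natDegree_le (hp.1 i) (hr.1 j)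
    fin_cases i <;> simp [_root_.symMul, hc]

lemma addSubMap (W : WeierstrassCurve F) [W.IsElliptic] {s : Fin 3 → F[X]} {M : ℕ}
    (hs : HasMaxDegree s M) :
    HasMaxDegree (fun i ↦ ((W.map C).addSubMap i).eval s) (2 * M) := by
  have hle (i j) : (s i * s j).natDegree ≤ 2 * M :=
    (natDegree_mul_le_of_le (hs.1 i) (hs.1 j)).trans (two_mul M).ge
  have hc (i j) : (s i * s j).coeff (2 * M) = (s i).coeff M * (s j).coeff M := by
    rw [two_mul]
    exact coeff_mul_add_eq_of_natDegree_le (hs.1 i) (hs.1 j)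
  have hC (a : F) (i j) : (C a * (s i * s j)).natDegree ≤ 2 * M :=
    (natDegree_C_mul_le _ _).trans (hle i j)
  have h0 : ((W.map C).addSubMap 0).eval s = s 0 * s 0 - C W.b₄ * (s 0 * s 2) -
      C W.b₆ * (s 1 * s 2) - C W.b₈ * (s 2 * s 2) := by
    simp [WeierstrassCurve.addSubMap]
    ring
  have h1 : ((W.map C).addSubMap 1).eval s = C 2 * (s 1 * s 0) + C W.b₂ * (s 0 * s 2) +
      C W.b₄ * (s 1 * s 2) + C W.b₆ * (s 2 * s 2) := by
    simp [WeierstrassCurve.addSubMap, C_ofNat]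
    ring
  have h2 : ((W.map C).addSubMap 2).eval s = s 1 * s 1 - C 4 * (s 0 * s 2) := by
    simp [WeierstrassCurve.addSubMap, C_ofNat]
    ring
  refine ⟨fun i ↦ ?_, ?_⟩
  · fin_cases i
    · simp only [Fin.zero_eta, h0]
      exact natDegree_sub_le_of_le (natDegree_sub_le_of_le (natDegree_sub_le_of_le
        (hle 0 0) (hC _ 0 2)) (hC _ 1 2)) (hC _ 2 2) |>.trans (by simp)
    · simp only [Fin.mk_one, h1]
      exact natDegree_add_le_of_le (natDegree_add_le_of_le (natDegree_add_le_of_le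
        (hC _ 1 0) (hC _ 0 2)) (hC _ 1 2)) (hC _ 2 2) |>.trans (by simp)
    · simp only [Fin.reduceFinMk, h2]
      exact natDegree_sub_le_of_le (hle 1 1) (hC _ 0 2) |>.trans (by simp)
  · convert WeierstrassCurve.addSubMap_ne_zero W hs.2 using 1
    ext i
    fin_cases i
    · simp only [Fin.zero_eta, h0, coeff_sub, coeff_C_mul, hc]
      simp [WeierstrassCurve.addSubMap]
      ring
    · simp only [Fin.mk_one, h1, coeff_add, coeff_C_mul, hc]
      simp [WeierstrassCurve.addSubMap]
      ring
    · simp only [Fin.reduceFinMk, h2, coeff_sub, coeff_C_mul, hc]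
      simp [WeierstrassCurve.addSubMap]
      ring

end HasMaxDegree
lemma isCoprime_symMul_of_prime {R : Type*} [CommRing R] {p r : Fin 2 → R}
    (hp : IsCoprime (p 0) (p 1)) (hr : IsCoprime (r 0) (r 1)) {z : R} (hz : Prime z)
    (h : ∀ i, z ∣ symMul p r i) : False := by
  have h0 : z ∣ p 0 * r 0 := h 0
  have h1 : z ∣ p 0 * r 1 + p 1 * r 0 := h 1
  have h2 : z ∣ p 1 * r 1 := h 2
  have hp' : ¬ (z ∣ p 0 ∧ z ∣ p 1) := fun h ↦ hz.not_isUnit (hp.isUnit_of_dvd' h.1 h.2)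
  have hr' : ¬ (z ∣ r 0 ∧ z ∣ r 1) := fun h ↦ hz.not_isUnit (hr.isUnit_of_dvd' h.1 h.2)
  rcases hz.dvd_or_dvd h0 with h0 | h0 <;> rcases hz.dvd_or_dvd h2 with h2 | h2
  · exact hp' ⟨h0, h2⟩
  · rcases hz.dvd_or_dvd ((dvd_add_right (h0.mul_right _)).mp h1) with h | h
    exacts [hp' ⟨h0, h⟩, hr' ⟨h, h2⟩]
  · rcases hz.dvd_or_dvd ((dvd_add_left (h2.mul_right _)).mp h1) with h | h
    exacts [hp' ⟨h, h2⟩, hr' ⟨h0, h⟩]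
  · exact hr' ⟨h0, h2⟩

lemma WeierstrassCurve.dvd_of_dvd_eval_addSubMap {R : Type*} [CommRing R]
    (W : WeierstrassCurve R) [W.IsElliptic] {s : Fin 3 → R} {z : R} (hz : Prime z)
    (h : ∀ i, z ∣ (addSubMap W i).eval s) (i : Fin 3) : z ∣ s i := by
  refine hz.dvd_of_dvd_pow (n := 4) ?_
  rw [← addSubMapCoeff_condition W s i]
  exact Finset.dvd_sum fun j _ ↦ (h j).mul_left _

/-- The ratio of two binary forms over a Bézout pair: if a product of linear forms has
coefficients in the image of `ι` and one factor is given by a coprime pair over `R`, then so is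
the other factor. -/
lemma exists_eq_symMul {R K : Type*} [CommRing R] [Field K] {ι : R →+* K}
    (hι : Function.Injective ι) {r : Fin 2 → R} (hr : IsCoprime (r 0) (r 1)) {t : Fin 3 → R}
    {v : Fin 2 → K} (h : ∀ i, ι (t i) = symMul (fun j ↦ ι (r j)) v i) :
    ∃ p : Fin 2 → R, (∀ i, ι (p i) = v i) ∧ t = symMul r p := by
  obtain ⟨a, b, hab⟩ := hr
  have h0 : ι (t 0) = ι (r 0) * v 0 := h 0
  have h1 : ι (t 1) = ι (r 0) * v 1 + ι (r 1) * v 0 := h 1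
  have h2 : ι (t 2) = ι (r 1) * v 1 := h 2
  have hab' : ι a * ι (r 0) + ι b * ι (r 1) = 1 := by
    rw [← map_mul, ← map_mul, ← map_add, hab, map_one]
  let p : Fin 2 → R := ![a * t 0 + b * (a * r 1 * t 0 + b * (r 1 * t 1 - r 0 * t 2)),
    b * t 2 + a * (b * r 0 * t 2 + a * (r 0 * t 1 - r 1 * t 0))]
  have hp0 : ι (p 0) = v 0 := by
    simp only [p, Matrix.cons_val, map_add, map_mul, map_sub, h0, h1, h2]
    linear_combination
      (v 0 + ι b * ι (r 1) * v 0) * hab'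
  have hp1 : ι (p 1) = v 1 := by
    simp only [p, Matrix.cons_val, map_add, map_mul, map_sub, h0, h1, h2]
    linear_combination
      (v 1 + ι a * ι (r 0) * v 1) * hab'
  refine ⟨p, fun i ↦ ?_, ?_⟩
  · fin_cases i
    exacts [hp0, hp1]
  · ext i
    apply hι
    rw [h]
    fin_cases i <;> simp [symMul, hp0, hp1]

section Height

variable {F K : Type*} [Field F] [Field K] {W : WeierstrassCurve F}
  {ι : F[X] →+* K}

/-- The `x`-coordinate of the point `P` is a rational function of degree `M`. -/
def HasHeight (W : WeierstrassCurve F) (ι : F[X] →+* K)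
    (P : ((W.map C).map ι).toAffine.Point) (M : ℕ) : Prop :=
  ∃ p : Fin 2 → F[X], IsCoprime (p 0) (p 1) ∧ HasMaxDegree p M ∧
    ∃ c : K, c ≠ 0 ∧ ∀ i, ι (p i) = c * P.xRep i

lemma HasHeight.neg {P : ((W.map C).map ι).toAffine.Point} {M : ℕ} (h : HasHeight W ι P M) :
    HasHeight W ι (-P) M := by
  simpa only [HasHeight, WeierstrassCurve.Affine.Point.xRep_neg] using h

/-- The exact parallelogram law for the height on a constant elliptic curve. -/
lemma HasHeight.add [DecidableEq K] [W.IsElliptic] (hι : Function.Injective ι)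
    {P Q : ((W.map C).map ι).toAffine.Point} {L M N : ℕ}
    (hP : HasHeight W ι P L) (hQ : HasHeight W ι Q M) (hPQ : HasHeight W ι (P - Q) N) :
    ∃ k, HasHeight W ι (P + Q) k ∧ N + k = 2 * (L + M) := by
  obtain ⟨p, hp, hpL, c, hc, hpc⟩ := hP
  obtain ⟨q, hq, hqM, d, hd, hqd⟩ := hQ
  obtain ⟨r, hr, hrN, e, he, hre⟩ := hPQ
  obtain ⟨k, hk, hadd⟩ := WeierstrassCurve.Affine.Point.eval_addSubMap_sym2x P Q
  have hs : (fun i ↦ ι (symMul p q i)) = fun i ↦ (c * d) * P.sym2x Q i := by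
    ext i
    fin_cases i <;>
      simp [symMul, WeierstrassCurve.Affine.Point.sym2x, hpc, hqd] <;> ring
  set t : Fin 3 → F[X] := fun i ↦ ((W.map C).addSubMap i).eval (symMul p q) with ht
  have htι (i) : ι (t i) = symMul (fun j ↦ ι (r j))
      (fun j ↦ (c * d) ^ 2 * k / e * (P + Q).xRep j) i := by
    rw [ht, ← WeierstrassCurve.eval_addSubMap_map, hs, WeierstrassCurve.eval_addSubMap_mul, hadd]
    fin_cases i <;>
      simp [symMul, WeierstrassCurve.Affine.Point.sym2x, hre] <;> field_simp
    ring
  obtain ⟨g, hg, htg⟩ := exists_eq_symMul hι hr htι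
  have hprime (z : F[X]) (hz : Prime z) (h0 : z ∣ g 0) (h1 : z ∣ g 1) : False := by
    refine isCoprime_symMul_of_prime hp hq hz
      (WeierstrassCurve.dvd_of_dvd_eval_addSubMap (W.map C) hz fun i ↦ ?_)
    change z ∣ t i
    rw [htg]
    fin_cases i
    · exact h0.mul_left _
    · exact dvd_add (h1.mul_left _) (h0.mul_left _)
    · exact h1.mul_left _
  have hg0 : g ≠ 0 := by
    rintro rfl
    exact hprime X prime_X (dvd_zero _) (dvd_zero _)
  obtain ⟨m, hm⟩ := HasMaxDegree.exists_of_ne_zero hg0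
  refine ⟨m, ⟨g, isCoprime_of_prime_dvd (fun h ↦ hg0 ?_) fun z hz h0 h1 ↦ hprime z hz h0 h1, hm,
    (c * d) ^ 2 * k / e, ?_, hg⟩, ?_⟩
  · ext i : 1
    fin_cases i
    exacts [h.1, h.2]
  · positivity
  · exact (htg ▸ hrN.symMul hm).unique ((hpL.symMul hqM).addSubMap W)

lemma HasHeight.add_nsmul [DecidableEq K] [W.IsElliptic] (hι : Function.Injective ι)
    {P Q : ((W.map C).map ι).toAffine.Point} {a b : ℕ} (hQ : HasHeight W ι Q 1)
    (hP : HasHeight W ι P a) (hPQ : HasHeight W ι (P - Q) b) (n : ℕ) :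
    (∃ k, HasHeight W ι (P + n • Q) k ∧ (k : ℤ) = n ^ 2 + (a + 1 - b) * n + a) ∧
      ∃ k, HasHeight W ι (P + n • Q - Q) k ∧
        (k : ℤ) = (n - 1) ^ 2 + (a + 1 - b) * (n - 1) + a := by
  induction n with
  | zero => exact ⟨⟨a, by simpa using hP, by simp⟩, ⟨b, by simpa using hPQ, by push_cast; ring⟩⟩
  | succ n ih =>
    obtain ⟨⟨k, hk, hk'⟩, ⟨l, hl, hl'⟩⟩ := ih
    obtain ⟨m, hm, hm'⟩ := hk.add hι hQ hl
    rw [succ_nsmul, ← add_assoc, add_sub_cancel_right]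
    refine ⟨⟨m, hm, ?_⟩, ⟨k, hk, by simpa using hk'⟩⟩
    zify at hm'
    push_cast
    linear_combination hm' + 2 * hk' - hl'

lemma HasHeight.add_zsmul [DecidableEq K] [W.IsElliptic] (hι : Function.Injective ι)
    {P Q : ((W.map C).map ι).toAffine.Point} {a b : ℕ} (hQ : HasHeight W ι Q 1)
    (hP : HasHeight W ι P a) (hPQ : HasHeight W ι (P - Q) b) (n : ℤ) :
    ∃ k : ℕ, HasHeight W ι (P + n • Q) k ∧ (k : ℤ) = n ^ 2 + (a + 1 - b) * n + a := by
  obtain ⟨n, rfl | rfl⟩ := n.eq_nat_or_neg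
  · simpa using (HasHeight.add_nsmul hι hQ hP hPQ n).1
  · obtain ⟨c, hc, hc'⟩ := (HasHeight.add_nsmul hι hQ hP hPQ 1).1
    rw [one_nsmul, ← sub_neg_eq_add] at hc
    obtain ⟨k, hk, hk'⟩ := (HasHeight.add_nsmul hι hQ.neg hP hc n).1
    refine ⟨k, by simpa using hk, ?_⟩
    push_cast at hc'
    linear_combination hk' - n * hc'

/-- The discriminant of the height, restricted to the lattice spanned by `P` and `Q`, is not
positive. -/
lemma HasHeight.sq_le [DecidableEq K] [W.IsElliptic] (hι : Function.Injective ι)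
    {P Q : ((W.map C).map ι).toAffine.Point} {a b : ℕ} (hQ : HasHeight W ι Q 1)
    (hP : HasHeight W ι P a) (hPQ : HasHeight W ι (P - Q) b) :
    ((b : ℤ) - (a + 1)) ^ 2 ≤ 4 * a := by
  by_contra! hlt
  have key := HasHeight.add_zsmul hι hQ hP hPQ
  obtain ⟨m, hm | hm⟩ := Int.even_or_odd' ((a : ℤ) + 1 - b)
  · obtain ⟨k, -, hk⟩ := key (-m)
    rw [hm] at hk
    have : ((b : ℤ) - (a + 1)) ^ 2 = 4 * m ^ 2 := by
      rw [show (b : ℤ) - (a + 1) = -(2 * m) by linarith]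
      ring
    nlinarith
  · obtain ⟨k, hkh, hk⟩ := key (-m)
    obtain ⟨l, hlh, hl⟩ := key (-m - 1)
    rw [hm] at hk hl
    have : ((b : ℤ) - (a + 1)) ^ 2 = 4 * (m ^ 2 + m) + 1 := by
      rw [show (b : ℤ) - (a + 1) = -(2 * m + 1) by linarith]
      ring
    have hk0 : k = 0 := by nlinarith
    have hl0 : l = 0 := by nlinarith
    subst hk0 hl0
    have hsub : P + (-m) • Q - (P + (-m - 1) • Q) = Q := by
      rw [sub_smul, one_smul]
      abel
    obtain ⟨j, -, hj⟩ := hkh.add hι hlh (hsub.symm ▸ hQ)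
    omega

end Height

lemma WeierstrassCurve.eval_addSubMap_of_equation {R : Type*} [CommRing R] {V : WeierstrassCurve R}
    {x y X Y : R} (h₁ : V.toAffine.Equation x y) (h₂ : V.toAffine.Equation X Y) :
    let S := Y + y + (V.a₁ * x + V.a₃)
    let D := Y - y
    let d := X - x
    let A := S ^ 2 + V.a₁ * S * d - (V.a₂ + X + x) * d ^ 2
    let B := D ^ 2 + V.a₁ * D * d - (V.a₂ + X + x) * d ^ 2
    A + B = (V.addSubMap 1).eval ![X * x, X + x, 1] ∧
    A * B = d ^ 2 * (V.addSubMap 0).eval ![X * x, X + x, 1] := by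
  intro S D d A B
  rw [WeierstrassCurve.Affine.equation_iff] at h₁ h₂
  have hT : S * D - d * (X ^ 2 + X * x + x ^ 2 + V.a₂ * (X + x) + V.a₄ - V.a₁ * Y) = 0 := by
    linear_combination h₂ - h₁
  set T := X ^ 2 + X * x + x ^ 2 + V.a₂ * (X + x) + V.a₄ - V.a₁ * Y with hTd
  simp only [WeierstrassCurve.addSubMap, WeierstrassCurve.b₂, WeierstrassCurve.b₄,
    WeierstrassCurve.b₆, WeierstrassCurve.b₈, Matrix.cons_val, map_add, map_sub, map_mul, map_pow,
    MvPolynomial.eval_X, MvPolynomial.eval_C]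
  constructor
  · linear_combination 2 * h₁ + 2 * h₂
  · linear_combination (S * D + d * T + V.a₁ * d * (S + D) + V.a₁ ^ 2 * d ^ 2) * hT -
      d ^ 2 * (V.a₁ ^ 2 * h₂ + 2 * (V.a₂ + X + x) * (h₁ + h₂))

section Frobenius

universe u

variable {F : Type u} [Field F]

lemma WeierstrassCurve.Affine.exists_equation {M : Type*} [Field M] [IsAlgClosed M]
    (V : WeierstrassCurve.Affine M) (x : M) : ∃ y, V.Equation x y := by
  obtain ⟨y, hy⟩ := IsAlgClosed.exists_root
    (C 1 * X ^ 2 + C (V.a₁ * x + V.a₃) * X + C (-(x ^ 3 + V.a₂ * x ^ 2 + V.a₄ * x + V.a₆)))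
    (by rw [degree_quadratic one_ne_zero]; decide)
  refine ⟨y, (V.equation_iff x y).mpr ?_⟩
  simp only [IsRoot.def, eval_add, eval_mul, eval_pow, eval_X, eval_C] at hy
  linear_combination hy

/-- A Weierstrass curve has a generic point. -/
lemma WeierstrassCurve.exists_injective_equation (W : WeierstrassCurve F) :
    ∃ (K : Type u) (_ : Field K) (ι : F[X] →+* K) (y : K), Function.Injective ι ∧
      ((W.map C).map ι).toAffine.Equation (ι X) y := by
  let K := AlgebraicClosure (RatFunc F)
  let ι : F[X] →+* K := (algebraMap (RatFunc F) K).comp (algebraMap F[X] (RatFunc F))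
  obtain ⟨y, hy⟩ := ((W.map C).map ι).toAffine.exists_equation (ι X)
  exact ⟨K, inferInstance, ι, y,
    (algebraMap (RatFunc F) K).injective.comp (IsFractionRing.injective F[X] (RatFunc F)), hy⟩

lemma exists_pow_eq_add_mul (h f : F[X]) (k : ℕ) :
    ∃ u v : F[X], ∀ (M : Type u) [Field M] (ι : F[X] →+* M) (y : M),
      y ^ 2 + ι h * y = ι f → y ^ k = ι u + ι v * y := by
  induction k with
  | zero => exact ⟨1, 0, fun M _ ι y _ ↦ by simp⟩
  | succ k ih =>
    obtain ⟨u, v, huv⟩ := ih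
    refine ⟨v * f, u - v * h, fun M _ ι y hy ↦ ?_⟩
    rw [pow_succ, huv M ι y hy]
    simp only [map_mul, map_sub]
    linear_combination ι v * hy

variable [Fintype F]

local notation "q" => Fintype.card F

lemma WeierstrassCurve.Affine.Equation.pow_card {M : Type*} [Field M] {W : WeierstrassCurve F}
    {ι : F[X] →+* M} {x y : M} (h : ((W.map C).map ι).toAffine.Equation x y) :
    ((W.map C).map ι).toAffine.Equation (x ^ q) (y ^ q) := by
  let : Algebra F M := (ι.comp C).toAlgebra
  let φ := FiniteField.frobeniusAlgHom F M
  have hφ : ((W.map C).map ι).map φ.toRingHom = (W.map C).map ι := by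
    rw [W.map_map, W.map_map]
    exact congrArg W.map φ.comp_algebraMap
  rw [← hφ]
  exact h.map φ.toRingHom

/-- The polynomials `A` and `B` are the numerators over the denominator `(X ^ q - X) ^ 2` of the
`x`-coordinates of `φ P - P` and `φ P + P`, with `P` a point with `x`-coordinate `X` and `φ` the
Frobenius endomorphism. -/
def IsFrobeniusNumerators (W : WeierstrassCurve F) (A B : F[X]) : Prop :=
  ∀ (M : Type u) [Field M] (ι : F[X] →+* M) (y : M),
    ((W.map C).map ι).toAffine.Equation (ι X) y →
    (ι A = (y ^ q + y + ι (C W.a₁ * X + C W.a₃)) ^ 2 +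
      ι (C W.a₁) * (y ^ q + y + ι (C W.a₁ * X + C W.a₃)) * ι (X ^ q - X) -
      ι (C W.a₂ + X ^ q + X) * ι (X ^ q - X) ^ 2) ∧
    ι B = (y ^ q - y) ^ 2 + ι (C W.a₁) * (y ^ q - y) * ι (X ^ q - X) -
      ι (C W.a₂ + X ^ q + X) * ι (X ^ q - X) ^ 2

lemma exists_isFrobeniusNumerators (W : WeierstrassCurve F) :
    ∃ A B : F[X], IsFrobeniusNumerators W A B := by
  set h : F[X] := C W.a₁ * X + C W.a₃ with hh
  set f : F[X] := X ^ 3 + C W.a₂ * X ^ 2 + C W.a₄ * X + C W.a₆ with hf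
  set d : F[X] := X ^ q - X with hd
  have hequiv (M : Type u) [Field M] (ι : F[X] →+* M) (y : M)
      (hy : ((W.map C).map ι).toAffine.Equation (ι X) y) : y ^ 2 + ι h * y = ι f := by
    rw [WeierstrassCurve.Affine.equation_iff] at hy
    simp only [WeierstrassCurve.map_a₁, WeierstrassCurve.map_a₂, WeierstrassCurve.map_a₃,
      WeierstrassCurve.map_a₄, WeierstrassCurve.map_a₆] at hy
    simp only [hh, hf, map_add, map_mul, map_pow]
    linear_combination hy
  obtain ⟨u, v, huv⟩ := exists_pow_eq_add_mul h f q
  have htrace : 2 * u - v * h + h + C W.a₁ * d = 0 := by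
    obtain ⟨K, _, ι, y, hι, hy⟩ := W.exists_injective_equation
    replace hy := hequiv K ι y hy
    have h1 := huv K ι y hy
    have h2 := huv K ι (-(y + ι h)) (by linear_combination hy)
    let : Algebra F K := (ι.comp C).toAlgebra
    have h3 : (-(y + ι h)) ^ q = -(y ^ q + ι h ^ q) := by
      let φ := FiniteField.frobeniusAlgHom F K
      exact (map_neg φ _).trans (congrArg _ (map_add φ y (ι h)))
    have h4 : h ^ q = h + C W.a₁ * d := by
      rw [← FiniteField.expand_card, hh, hd]
      simp only [map_add, map_mul, expand_C, expand_X]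
      ring
    apply hι
    rw [← map_pow, h4] at h3
    simp only [map_add, map_sub, map_mul, map_zero, map_ofNat] at h3 ⊢
    linear_combination h3 - h1 - h2
  refine ⟨(u + h) ^ 2 + (v + 1) ^ 2 * f + C W.a₁ * (u + h) * d - (C W.a₂ + X ^ q + X) * d ^ 2,
    u ^ 2 + (v - 1) ^ 2 * f + C W.a₁ * u * d - (C W.a₂ + X ^ q + X) * d ^ 2,
    fun M _ ι y hy ↦ ?_⟩
  replace hy := hequiv M ι y hy
  have htr := congrArg ι htrace
  rw [huv M ι y hy]
  simp only [hd, hh, hf, map_add, map_sub, map_mul, map_pow, map_zero, map_one, map_ofNat]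
    at hy htr ⊢
  exact ⟨by linear_combination (-(ι v + 1) ^ 2) * hy - (ι v + 1) * y * htr,
    by linear_combination (-(ι v - 1) ^ 2) * hy - (ι v - 1) * y * htr⟩

lemma exists_isFrobeniusNumerators_eval_addSubMap (W : WeierstrassCurve F) :
    ∃ A B : F[X], IsFrobeniusNumerators W A B ∧
      A + B = ((W.map C).addSubMap 1).eval ![X ^ q * X, X ^ q + X, 1] ∧
      A * B = (X ^ q - X) ^ 2 * ((W.map C).addSubMap 0).eval ![X ^ q * X, X ^ q + X, 1] := by
  obtain ⟨A, B, hAB⟩ := exists_isFrobeniusNumerators W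
  refine ⟨A, B, hAB, ?_⟩
  obtain ⟨K, _, ι, y, hι, hy⟩ := W.exists_injective_equation
  obtain ⟨hA, hB⟩ := hAB K ι y hy
  obtain ⟨h1, h2⟩ := WeierstrassCurve.eval_addSubMap_of_equation hy hy.pow_card
  have hs : (fun j ↦ ι ((![X ^ q * X, X ^ q + X, 1] : Fin 3 → F[X]) j)) =
      ![ι X ^ q * ι X, ι X ^ q + ι X, 1] := by
    ext i
    fin_cases i <;> simp
  constructor <;> apply hι
  · rw [map_add, hA, hB, ← WeierstrassCurve.eval_addSubMap_map, hs, ← h1]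
    simp
  · rw [map_mul, map_mul, hA, hB, ← WeierstrassCurve.eval_addSubMap_map, hs]
    simp at h2 ⊢
    exact h2

lemma eval_addSubMap_eval (W : WeierstrassCurve F) (x : F) (i : Fin 3) :
    (((W.map C).addSubMap i).eval ![X ^ q * X, X ^ q + X, 1]).eval x =
      (W.addSubMap i).eval ![x ^ 2, 2 * x, 1] := by
  have h := WeierstrassCurve.eval_addSubMap_map (W.map C) (evalRingHom x)
    ![X ^ q * X, X ^ q + X, 1] i
  rw [WeierstrassCurve.map_map, show (evalRingHom x).comp C = RingHom.id F by ext; simp,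
    WeierstrassCurve.map_id] at h
  rw [← coe_evalRingHom, ← h]
  congr 2
  ext j
  fin_cases j <;> simp [FiniteField.pow_card] <;> ring

lemma natDegree_of_add_mul {A B : F[X]} (W : WeierstrassCurve F)
    (hadd : A + B = ((W.map C).addSubMap 1).eval ![X ^ q * X, X ^ q + X, 1])
    (hmul : A * B =
      (X ^ q - X) ^ 2 * ((W.map C).addSubMap 0).eval ![X ^ q * X, X ^ q + X, 1]) :
    A * B ≠ 0 ∧ A.natDegree = 2 * q + 1 := by
  have hq : 1 < q := Fintype.one_lt_card
  have hd : (X ^ q - X : F[X]).natDegree = q := FiniteField.X_pow_card_sub_X_natDegree_eq F hq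
  have hd0 : (X ^ q - X : F[X]) ≠ 0 := FiniteField.X_pow_card_sub_X_ne_zero F hq
  have hle : (A + B).natDegree ≤ 2 * q + 1 := by
    rw [hadd]
    simp only [WeierstrassCurve.addSubMap, Matrix.cons_val, map_add, map_mul,
      MvPolynomial.eval_X, MvPolynomial.eval_C, WeierstrassCurve.map_b₂, WeierstrassCurve.map_b₄,
      WeierstrassCurve.map_b₆]
    compute_degree
    simp
    omega
  have h0 : (((W.map C).addSubMap 0).eval ![X ^ q * X, X ^ q + X, 1]).natDegree = 2 * q + 2 := by
    simp only [WeierstrassCurve.addSubMap, Matrix.cons_val, map_add, map_sub, map_mul, map_pow,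
      MvPolynomial.eval_X, MvPolynomial.eval_C, WeierstrassCurve.map_b₄, WeierstrassCurve.map_b₆,
      WeierstrassCurve.map_b₈, ← pow_succ, ← pow_mul, mul_one, one_pow, sub_sub]
    rw [natDegree_sub_eq_left_of_natDegree_lt] <;> rw [natDegree_X_pow]
    · ring
    · refine Nat.lt_of_le_of_lt (m := q + 1) ?_ (by omega)
      compute_degree
  have h00 : ((W.map C).addSubMap 0).eval ![X ^ q * X, X ^ q + X, 1] ≠ 0 := by
    intro h
    simp [h] at h0
  have hAB : A * B ≠ 0 := hmul ▸ mul_ne_zero (pow_ne_zero 2 hd0) h00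
  refine ⟨hAB, ?_⟩
  have hdeg : A.natDegree + B.natDegree = 4 * q + 2 := by
    rw [← natDegree_mul (left_ne_zero_of_mul hAB) (right_ne_zero_of_mul hAB), hmul,
      natDegree_mul (pow_ne_zero 2 hd0) h00, natDegree_pow, hd, h0]
    ring
  obtain h | h | h := lt_trichotomy A.natDegree B.natDegree
  · rw [natDegree_add_eq_right_of_natDegree_lt h] at hle
    omega
  · omega
  · rw [natDegree_add_eq_left_of_natDegree_lt h] at hle
    omega

lemma prod_X_sub_C_eq_X_pow_card_sub_X : ∏ x : F, (X - C x) = X ^ q - X := by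
  have hq : 1 < q := Fintype.one_lt_card
  have hd : (X ^ q - X : F[X]).natDegree = q := FiniteField.X_pow_card_sub_X_natDegree_eq F hq
  have h := prod_multiset_X_sub_C_of_monic_of_roots_card_eq (p := (X ^ q - X : F[X]))
    (monic_X_pow_sub (by simpa using hq)) (by
      rw [hd, FiniteField.roots_X_pow_card_sub_X]
      rfl)
  rwa [FiniteField.roots_X_pow_card_sub_X] at h

lemma rootMultiplicity_X_pow_card_sub_X (x : F) : (X ^ q - X : F[X]).rootMultiplicity x = 1 := by
  classical
  rw [← count_roots, FiniteField.roots_X_pow_card_sub_X]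
  exact Multiset.count_eq_one_of_mem Finset.univ.nodup (Finset.mem_univ x)

lemma exists_algebraMap_eq_of_pow_card_eq {M : Type*} [Field M] [Algebra F M] {y : M}
    (hy : y ^ q = y) : ∃ a : F, algebraMap F M a = y := by
  have h := congrArg (aeval y) (prod_X_sub_C_eq_X_pow_card_sub_X (F := F))
  simp only [map_prod, map_sub, map_pow, aeval_X, aeval_C, hy, sub_self] at h
  obtain ⟨a, -, ha⟩ := Finset.prod_eq_zero_iff.mp h
  exact ⟨a, (sub_eq_zero.mp ha).symm⟩

lemma ncard_equation_and_rootMultiplicity (W : WeierstrassCurve F) [W.IsElliptic] {A B : F[X]}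
    (hAB : IsFrobeniusNumerators W A B)
    (hadd : A + B = ((W.map C).addSubMap 1).eval ![X ^ q * X, X ^ q + X, 1])
    (hmul : A * B =
      (X ^ q - X) ^ 2 * ((W.map C).addSubMap 0).eval ![X ^ q * X, X ^ q + X, 1]) (x : F) :
    {y | W.toAffine.Equation x y}.ncard = 0 ∧ 2 ≤ A.rootMultiplicity x ∨
    {y | W.toAffine.Equation x y}.ncard = 1 ∧ A.rootMultiplicity x = 1 ∨
    {y | W.toAffine.Equation x y}.ncard = 2 ∧ A.rootMultiplicity x = 0 := by
  have hAB0 := (natDegree_of_add_mul W hadd hmul).1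
  have hA0 := left_ne_zero_of_mul hAB0
  have hB0 := right_ne_zero_of_mul hAB0
  have hd0 : (X ^ q - X : F[X]) ≠ 0 := FiniteField.X_pow_card_sub_X_ne_zero F Fintype.one_lt_card
  have hmult := rootMultiplicity_mul (x := x) hAB0
  rw [hmul, rootMultiplicity_mul (hmul ▸ hAB0), pow_two, rootMultiplicity_mul (mul_ne_zero hd0 hd0),
    rootMultiplicity_X_pow_card_sub_X] at hmult
  have heval (M : Type u) [Field M] [Algebra F M] (y : M)
      (hy : (W.map (algebraMap F M)).toAffine.Equation (algebraMap F M x) y) :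
      algebraMap F M (A.eval x) = (y ^ q + y + algebraMap F M (W.a₁ * x + W.a₃)) ^ 2 ∧
        algebraMap F M (B.eval x) = (y ^ q - y) ^ 2 := by
    have hι : (W.map C).map ((algebraMap F M).comp (evalRingHom x)) = W.map (algebraMap F M) := by
      rw [WeierstrassCurve.map_map]
      congr 1
      ext
      simp
    have := hAB M ((algebraMap F M).comp (evalRingHom x)) y (by rw [hι]; simpa using hy)
    simpa [FiniteField.pow_card] using this
  by_cases hex : ∃ y, W.toAffine.Equation x y
  · obtain ⟨y, hy⟩ := hex
    have hset : {y | W.toAffine.Equation x y} = {y, -y - W.a₁ * x - W.a₃} := by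
      ext z
      simp only [Set.mem_ofPred_eq, Set.mem_insert_iff, Set.mem_singleton_iff]
      rw [WeierstrassCurve.Affine.equation_iff] at hy ⊢
      rw [← sub_eq_zero (a := z), ← sub_eq_zero (a := z) (b := -y - W.a₁ * x - W.a₃), ← mul_eq_zero,
        ← sub_eq_zero]
      constructor <;> intro h
      · linear_combination h - hy
      · linear_combination h + hy
    obtain ⟨hA, hB⟩ := heval F y (by simpa using hy)
    simp only [Algebra.algebraMap_self, RingHom.id_apply, FiniteField.pow_card] at hA hB
    by_cases hyy : y = -y - W.a₁ * x - W.a₃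
    · right; left
      rw [hset, ← hyy, Set.pair_eq_singleton, Set.ncard_singleton]
      have hA1 : A.IsRoot x := by
        rw [IsRoot.def, hA]
        linear_combination (y + y + (W.a₁ * x + W.a₃)) * hyy
      have hB1 : B.IsRoot x := by
        rw [IsRoot.def, hB]
        ring
      have hF0 : rootMultiplicity x
          (((W.map C).addSubMap 0).eval ![X ^ q * X, X ^ q + X, 1]) = 0 := by
        refine rootMultiplicity_eq_zero fun h ↦ ?_
        have hF1 := congrArg (eval x) hadd
        rw [eval_add, hA1, hB1, eval_addSubMap_eval] at hF1
        rw [IsRoot.def, eval_addSubMap_eval] at h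
        refine W.addSubMap_ne_zero (x := ![x ^ 2, 2 * x, 1]) (fun h ↦ ?_) (funext fun i ↦ ?_)
        · simpa using congrFun h 2
        · fin_cases i
          · exact h
          · simpa using hF1.symm
          · simp [WeierstrassCurve.addSubMap]
            ring
      have := (rootMultiplicity_pos hA0).mpr hA1
      have := (rootMultiplicity_pos hB0).mpr hB1
      omega
    · right; right
      rw [hset, Set.ncard_pair hyy]
      refine ⟨rfl, rootMultiplicity_eq_zero fun h ↦ hyy ?_⟩
      rw [IsRoot.def, hA] at h
      linear_combination pow_eq_zero_iff two_ne_zero |>.mp h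
  · left
    refine ⟨(Set.ncard_eq_zero).mpr
      (Set.eq_empty_iff_forall_notMem.mpr (not_exists.mp hex)), ?_⟩
    obtain ⟨y, hy⟩ := (W.map (algebraMap F (AlgebraicClosure F))).toAffine.exists_equation
      (algebraMap F _ x)
    have hB1 : ¬ B.IsRoot x := fun h ↦ by
      have h1 := (heval _ y hy).2
      rw [h, map_zero] at h1
      obtain ⟨z, rfl⟩ := exists_algebraMap_eq_of_pow_card_eq
        (sub_eq_zero.mp (pow_eq_zero_iff two_ne_zero |>.mp h1.symm))
      exact hex ⟨z,
        (W.toAffine.map_equation (algebraMap F (AlgebraicClosure F)).injective x z).mp hy⟩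
    have := rootMultiplicity_eq_zero hB1
    omega

lemma WeierstrassCurve.Affine.natCard_point (W : WeierstrassCurve.Affine F) [W.IsElliptic] :
    Nat.card W.Point = ∑ x, {y | W.Equation x y}.ncard + 1 := by
  rw [Nat.card_congr W.pointEquiv]
  change Nat.card (Option _) = _
  rw [Finite.card_option,
    Nat.card_congr (Equiv.subtypeProdEquivSigmaSubtype fun x y ↦ W.Equation x y), Nat.card_sigma]
  rfl

/-- The difference of the Frobenius endomorphism and the identity has degree the number of
rational points. -/
lemma exists_isCoprime_of_frobenius_sub (W : WeierstrassCurve F) [W.IsElliptic] {A B : F[X]}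
    (hAB : IsFrobeniusNumerators W A B)
    (hadd : A + B = ((W.map C).addSubMap 1).eval ![X ^ q * X, X ^ q + X, 1])
    (hmul : A * B =
      (X ^ q - X) ^ 2 * ((W.map C).addSubMap 0).eval ![X ^ q * X, X ^ q + X, 1]) :
    ∃ G A₁ D : F[X], A = G * A₁ ∧ (X ^ q - X) ^ 2 = G * D ∧ IsCoprime A₁ D ∧
      HasMaxDegree ![A₁, D] (Nat.card W.toAffine.Point) := by
  obtain ⟨hAB0, hAdeg⟩ := natDegree_of_add_mul W hadd hmul
  have hA0 := left_ne_zero_of_mul hAB0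
  have hq : 1 < q := Fintype.one_lt_card
  have hd : (X ^ q - X : F[X]).natDegree = q := FiniteField.X_pow_card_sub_X_natDegree_eq F hq
  let n (x : F) : ℕ := {y | W.toAffine.Equation x y}.ncard
  have hloc (x : F) : n x = 0 ∧ 2 ≤ A.rootMultiplicity x ∨ n x = 1 ∧ A.rootMultiplicity x = 1 ∨
      n x = 2 ∧ A.rootMultiplicity x = 0 :=
    ncard_equation_and_rootMultiplicity W hAB hadd hmul x
  have hcard : Nat.card W.toAffine.Point = ∑ x, n x + 1 := W.toAffine.natCard_point
  let G : F[X] := ∏ x, (X - C x) ^ (2 - n x)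
  let D : F[X] := ∏ x, (X - C x) ^ n x
  have hGD : (X ^ q - X) ^ 2 = G * D := by
    rw [← prod_X_sub_C_eq_X_pow_card_sub_X, ← Finset.prod_pow, ← Finset.prod_mul_distrib]
    refine Finset.prod_congr rfl fun x _ ↦ ?_
    rw [← pow_add]
    congr 1
    have := hloc x
    omega
  obtain ⟨A₁, hA₁⟩ : G ∣ A := by
    refine Finset.prod_dvd_of_coprime (fun x _ y _ hxy ↦ (isCoprime_X_sub_C_of_isUnit_sub
      (sub_ne_zero.mpr hxy).isUnit).pow) fun x _ ↦ (le_rootMultiplicity_iff hA0).mp ?_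
    have := hloc x
    omega
  have hcop : IsCoprime A₁ D := by
    refine IsCoprime.prod_right fun x _ ↦ ?_
    obtain h0 | h0 := Nat.eq_zero_or_pos (n x)
    · rw [h0, pow_zero]
      exact isCoprime_one_right
    · refine IsCoprime.pow_right (((irreducible_X_sub_C x).coprime_iff_not_dvd.mpr fun h ↦ ?_).symm)
      have h1 : (X - C x) ^ (2 - n x + 1) ∣ A := by
        rw [hA₁, pow_succ]
        exact mul_dvd_mul (Finset.dvd_prod_of_mem _ (Finset.mem_univ x)) h
      have := (le_rootMultiplicity_iff hA0).mpr h1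
      have := hloc x
      omega
  have hDdeg : D.natDegree + 1 = Nat.card W.toAffine.Point := by
    rw [hcard, natDegree_prod_of_monic _ _ fun x _ ↦ (monic_X_sub_C x).pow _]
    simp
  have hG0 : G ≠ 0 := left_ne_zero_of_mul (hA₁ ▸ hA0)
  have hA₁0 : A₁ ≠ 0 := right_ne_zero_of_mul (hA₁ ▸ hA0)
  have hD0 : D ≠ 0 := (monic_prod_of_monic _ _ fun x _ ↦ (monic_X_sub_C x).pow _).ne_zero
  have hA₁deg : A₁.natDegree = Nat.card W.toAffine.Point := by
    have h1 := congrArg natDegree hGD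
    rw [natDegree_pow, hd, natDegree_mul hG0 hD0] at h1
    rw [hA₁, natDegree_mul hG0 hA₁0] at hAdeg
    omega
  refine ⟨G, A₁, D, hA₁, hGD, hcop, fun i ↦ ?_, fun h ↦ hA₁0 ?_⟩
  · fin_cases i
    · exact hA₁deg.le
    · exact Nat.le_of_lt (hDdeg ▸ Nat.lt_succ_self _)
  · rw [← leadingCoeff_eq_zero, leadingCoeff, hA₁deg]
    exact congrFun h 0

lemma sq_natCard_point_sub_le (W : WeierstrassCurve F) [W.IsElliptic] :
    ((Nat.card W.toAffine.Point : ℤ) - (q + 1)) ^ 2 ≤ 4 * q := by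
  classical
  obtain ⟨A, B, hAB, hadd, hmul⟩ := exists_isFrobeniusNumerators_eval_addSubMap W
  obtain ⟨G, A₁, D, hA₁, hGD, hcop, hdeg⟩ := exists_isCoprime_of_frobenius_sub W hAB hadd hmul
  obtain ⟨K, _, ι, y, hι, hy⟩ := W.exists_injective_equation
  have hq : 1 < q := Fintype.one_lt_card
  have hd0 : ι (X ^ q - X) ≠ 0 :=
    (map_ne_zero_iff ι hι).mpr (FiniteField.X_pow_card_sub_X_ne_zero F hq)
  have hX : ι X ^ q ≠ ι X := by simpa [sub_ne_zero] using hd0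
  let Q : ((W.map C).map ι).toAffine.Point := .mk hy
  let P : ((W.map C).map ι).toAffine.Point := .mk hy.pow_card
  have hQ : HasHeight W ι Q 1 := by
    refine ⟨![X, 1], isCoprime_one_right, ⟨fun i ↦ ?_, fun h ↦ ?_⟩, 1, one_ne_zero, fun i ↦ ?_⟩
    · fin_cases i <;> simp
    · simpa using congrFun h 0
    · fin_cases i <;> simp [Q, WeierstrassCurve.Affine.Point.mk]
  have hP : HasHeight W ι P q := by
    refine ⟨![X ^ q, 1], isCoprime_one_right, ⟨fun i ↦ ?_, fun h ↦ ?_⟩, 1, one_ne_zero,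
      fun i ↦ ?_⟩
    · fin_cases i <;> simp
    · simpa using congrFun h 0
    · fin_cases i <;> simp [P, WeierstrassCurve.Affine.Point.mk]
  refine HasHeight.sq_le hι hQ hP ⟨![A₁, D], hcop, hdeg, ι D, ?_, fun i ↦ ?_⟩
  · refine (map_ne_zero_iff ι hι).mpr fun h ↦ hd0 ?_
    rw [h, mul_zero] at hGD
    rw [pow_eq_zero_iff two_ne_zero |>.mp hGD, map_zero]
  · have hG0 : ι G ≠ 0 := fun h ↦ hd0 <| by
      rw [← pow_eq_zero_iff two_ne_zero, ← map_pow, hGD, map_mul, h, zero_mul]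
    have hsub : P - Q = .some _ _ _ :=
      (sub_eq_add_neg P Q).trans (WeierstrassCurve.Affine.Point.add_of_X_ne hX)
    change ι (![A₁, D] i) = ι D * (P - Q).xRep i
    rw [hsub, WeierstrassCurve.Affine.Point.xRep_some]
    fin_cases i
    · have hA := (hAB K ι y hy).1
      rw [hA₁, map_mul] at hA
      have hGD' := congrArg ι hGD
      rw [map_mul, map_pow] at hGD'
      have hd : ι (X ^ q - X) = ι X ^ q - ι X := by simp
      rw [hd] at hA hGD'
      replace hX := sub_ne_zero.mpr hX
      change ι A₁ = ι D * ((W.map C).map ι).toAffine.addX (ι X ^ q) (ι X)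
        (((W.map C).map ι).toAffine.slope (ι X ^ q) (ι X) (y ^ q)
          (((W.map C).map ι).toAffine.negY (ι X) y))
      rw [WeierstrassCurve.Affine.slope_of_X_ne (sub_ne_zero.mp hX), WeierstrassCurve.Affine.addX,
        WeierstrassCurve.Affine.negY]
      apply mul_left_cancel₀ hG0
      rw [hA, ← mul_assoc, ← hGD']
      simp only [WeierstrassCurve.map_a₁, WeierstrassCurve.map_a₂, WeierstrassCurve.map_a₃,
        map_add, map_mul, map_pow]
      field_simp
      ring
    · simp

end Frobenius

/-- **Hasse's theorem.** Let `F` be a finite field with `q` elements and let `E` be an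
elliptic curve over `F` (a Weierstrass curve with nonzero discriminant). Then the number
`N` of `F`-rational points of `E` (including the point at infinity) satisfies
`|N - (q + 1)| ≤ 2√q`. -/
theorem hasse_bound (F : Type*) [Field F] [Fintype F]
    (W : WeierstrassCurve F) (hΔ : W.Δ ≠ 0) :
    |(Nat.card W.toAffine.Point : ℝ) - (Fintype.card F + 1)| ≤
      2 * Real.sqrt (Fintype.card F) := by
  have : W.IsElliptic := ⟨isUnit_iff_ne_zero.mpr hΔ⟩
  refine abs_le_of_sq_le_sq ?_ (by positivity)
  rw [mul_pow, Real.sq_sqrt (by positivity)]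
  have := sq_natCard_point_sub_le W
  norm_num
  exact_mod_cast this
end

section
/- For every prime p ≥ 5, the sum of a_p(A,B)² over all pairs (A,B) ∈ (ℤ/pℤ)² with 4A³ + 27B² ≠ 0 equals (p² - 1)(p - 1). (Equivalently, since there are exactly p² - p such pairs, the second moment of a_p is p - p⁻¹; this is Birch's formula M₂(a_p) = p - p⁻¹.) -/
section FiniteField

variable {F : Type*} [Field F] [Fintype F] [DecidableEq F]

lemma natCard_sq_eq_eq_sum_quadraticChar (hF : ringChar F ≠ 2) (h : F → F) :
    (Nat.card {xy : F × F // xy.2 ^ 2 = h xy.1} : ℤ) =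
      Fintype.card F + ∑ x, quadraticChar F (h x) := by
  have e : {xy : F × F // xy.2 ^ 2 = h xy.1} ≃ Σ x : F, {y : F | y ^ 2 = h x} :=
    { toFun := fun z => ⟨z.1.1, z.1.2, z.2⟩
      invFun := fun z => ⟨(z.1, z.2.1), z.2.2⟩
      left_inv := fun _ => rfl
      right_inv := fun _ => rfl }
  rw [Nat.card_congr e, Nat.card_eq_fintype_card, Fintype.card_sigma]
  simp_rw [← Set.toFinset_card]
  push_cast
  simp_rw [quadraticChar_card_sqrts hF, Finset.sum_add_distrib]
  simp [add_comm]

lemma quadraticChar_mul_self {a : F} (ha : a ≠ 0) :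
    quadraticChar F a * quadraticChar F a = 1 := by
  rw [← sq, quadraticChar_sq_one ha]

lemma sum_quadraticChar_add_mul_quadraticChar_add (hF : ringChar F ≠ 2) (a b : F) :
    ∑ t, quadraticChar F (t + a) * quadraticChar F (t + b) =
      (if a = b then (Fintype.card F : ℤ) else 0) - 1 := by
  split_ifs with hab
  · subst hab
    have hshift := Equiv.sum_comp (Equiv.addRight a) fun t => quadraticChar F t * quadraticChar F t
    simp only [Equiv.coe_addRight] at hshift
    rw [hshift, ← Finset.sum_erase_add _ _ (Finset.mem_univ (0 : F)),
      Finset.sum_congr rfl fun t ht => quadraticChar_mul_self (Finset.ne_of_mem_erase ht)]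
    simp [Finset.card_erase_of_mem, Nat.cast_sub Fintype.card_pos]
  · have hd : a - b ≠ 0 := sub_ne_zero.mpr hab
    rw [← Equiv.sum_comp ((Equiv.mulLeft₀ _ hd).trans (Equiv.subRight a))]
    have key (t : F) : quadraticChar F ((a - b) * t - a + a) *
        quadraticChar F ((a - b) * t - a + b) =
        quadraticChar F (-1) * (quadraticChar F t * quadraticChar F (1 - t)) := by
      rw [show (a - b) * t - a + a = (a - b) * t by ring,
        show (a - b) * t - a + b = (a - b) * (-1 * (1 - t)) by ring]
      simp only [map_mul]
      linear_combination (quadraticChar F t * quadraticChar F (-1) * quadraticChar F (1 - t)) *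
        quadraticChar_mul_self hd
    have hJ := jacobiSum_nontrivial_inv (quadraticChar_ne_one hF)
    rw [(quadraticChar_isQuadratic F).inv, jacobiSum] at hJ
    have h1 := quadraticChar_mul_self (neg_ne_zero.mpr (one_ne_zero (α := F)))
    simp only [Equiv.trans_apply, Equiv.mulLeft₀_apply, Equiv.subRight_apply, key,
      ← Finset.mul_sum, hJ]
    linear_combination -h1

lemma sum_ite_cube_add_mul_eq (x y : F) :
    ∑ A : F, (if x ^ 3 + A * x = y ^ 3 + A * y then (Fintype.card F : ℤ) else 0) =
      if x = y then (Fintype.card F : ℤ) ^ 2 else Fintype.card F := by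
  split_ifs with hxy
  · simp [hxy, sq]
  · have key (A : F) : x ^ 3 + A * x = y ^ 3 + A * y ↔ A = -(x ^ 2 + x * y + y ^ 2) := by
      refine ⟨fun h => mul_left_cancel₀ (sub_ne_zero.mpr hxy) ?_, fun h => ?_⟩
      · linear_combination h
      · linear_combination (x - y) * h
    simp [key]

lemma sum_sq_sum_quadraticChar_cubic (hF : ringChar F ≠ 2) :
    ∑ AB : F × F, (∑ x, quadraticChar F (x ^ 3 + AB.1 * x + AB.2)) ^ 2 =
      (Fintype.card F : ℤ) ^ 3 - (Fintype.card F : ℤ) ^ 2 := by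
  have h1 (A : F) : ∑ B : F, (∑ x, quadraticChar F (x ^ 3 + A * x + B)) ^ 2 =
      ∑ x, ∑ y, ((if x ^ 3 + A * x = y ^ 3 + A * y then (Fintype.card F : ℤ) else 0) - 1) := by
    simp_rw [sq, Finset.sum_mul_sum]
    rw [Finset.sum_comm]
    refine Finset.sum_congr rfl fun x _ => ?_
    rw [Finset.sum_comm]
    refine Finset.sum_congr rfl fun y _ => ?_
    rw [← sum_quadraticChar_add_mul_quadraticChar_add hF]
    simp_rw [add_comm _ (_ + _ * _)]
  rw [Fintype.sum_prod_type]
  simp_rw [h1]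
  rw [Finset.sum_comm]
  have h2 (x : F) : ∑ A : F, ∑ y,
      ((if x ^ 3 + A * x = y ^ 3 + A * y then (Fintype.card F : ℤ) else 0) - 1) =
      (Fintype.card F : ℤ) ^ 2 - Fintype.card F := by
    rw [Finset.sum_comm]
    simp_rw [Finset.sum_sub_distrib, sum_ite_cube_add_mul_eq]
    rw [← Finset.sum_erase_add _ _ (Finset.mem_univ x),
      Finset.sum_congr rfl fun y hy => if_neg (Finset.ne_of_mem_erase hy).symm]
    simp [Finset.card_erase_of_mem, Nat.cast_sub Fintype.card_pos]
    ring
  simp_rw [h2]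
  simp
  ring

lemma sq_sum_quadraticChar_singular_cubic (hF : ringChar F ≠ 2) (h3 : (3 : F) ≠ 0) (c : F) :
    (∑ x, quadraticChar F (x ^ 3 + -3 * c ^ 2 * x + 2 * c ^ 3)) ^ 2 = if c = 0 then 0 else 1 := by
  have key (x : F) : quadraticChar F (x ^ 3 + -3 * c ^ 2 * x + 2 * c ^ 3) =
      quadraticChar F (x + 2 * c) - if x = c then quadraticChar F (3 * c) else 0 := by
    rw [show x ^ 3 + -3 * c ^ 2 * x + 2 * c ^ 3 = (x - c) ^ 2 * (x + 2 * c) by ring]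
    split_ifs with hx
    · subst hx
      simp [show x + 2 * x = 3 * x by ring]
    · rw [map_mul, quadraticChar_sq_one' (sub_ne_zero.mpr hx), one_mul, sub_zero]
  have h0 : ∑ x, quadraticChar F (x + 2 * c) = 0 := by
    have hshift := Equiv.sum_comp (Equiv.addRight (2 * c)) (quadraticChar F)
    simpa only [Equiv.coe_addRight, quadraticChar_sum_zero hF] using hshift
  simp_rw [key, Finset.sum_sub_distrib, h0, Finset.sum_ite_eq', Finset.mem_univ, if_true, zero_sub,
    neg_sq]
  split_ifs with hc
  · simp [hc]
  · exact quadraticChar_sq_one (mul_ne_zero h3 hc)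

lemma sum_singular_cubic {M : Type*} [AddCommMonoid M] (h2 : (2 : F) ≠ 0) (h3 : (3 : F) ≠ 0)
    (f : F × F → M) :
    ∑ AB : F × F with ¬ 4 * AB.1 ^ 3 + 27 * AB.2 ^ 2 ≠ 0, f AB =
      ∑ c : F, f (-3 * c ^ 2, 2 * c ^ 3) := by
  symm
  refine Finset.sum_bij (fun c _ => (-3 * c ^ 2, 2 * c ^ 3)) ?_ ?_ ?_ fun _ _ => rfl
  · intro c _
    simp only [Finset.mem_filter, Finset.mem_univ, true_and, not_not]
    ring
  · intro c _ d _ h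
    obtain ⟨hA, hB⟩ := Prod.mk.inj h
    have hA := mul_left_cancel₀ (neg_ne_zero.mpr h3) hA
    have hB := mul_left_cancel₀ h2 hB
    by_cases hc : c = 0
    · subst hc
      exact (pow_eq_zero_iff two_ne_zero |>.mp (by simpa using hA.symm)).symm
    · refine mul_left_cancel₀ (pow_ne_zero 2 hc) ?_
      linear_combination hB - d * hA
  · rintro ⟨A, B⟩ h
    simp only [Finset.mem_filter, Finset.mem_univ, true_and, not_not] at h
    by_cases hA : A = 0
    · have hB : B = 0 := by
        have h27 : (27 : F) ≠ 0 := by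
          rw [show (27 : F) = 3 ^ 3 by norm_num]
          exact pow_ne_zero 3 h3
        simpa [hA, h27] using h
      exact ⟨0, Finset.mem_univ _, by simp [hA, hB]⟩
    · refine ⟨-3 * B / (2 * A), Finset.mem_univ _, Prod.ext ?_ ?_⟩
      · field_simp
        linear_combination -h
      · field_simp
        linear_combination -B * h

end FiniteField

/-- **Birch's formula** `M₂(a_p) = p - p⁻¹` for a prime `p ≥ 5`: the sum of
`a_p(A,B)^2` over all pairs `(A,B) ∈ (ℤ/pℤ)²` with `4A³ + 27B² ≠ 0` equals
`(p : ℤ) ^ 2 - 1`, where `a_p(A,B) = p - #{(x,y) : y² = x³ + Ax + B}`. -/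
theorem birch_second_moment (p : ℕ) [Fact p.Prime] (hp5 : 5 ≤ p) :
    ∑ AB ∈ Finset.univ.filter
        (fun AB : ZMod p × ZMod p => 4 * AB.1 ^ 3 + 27 * AB.2 ^ 2 ≠ 0),
      ((p : ℤ) -
        (Nat.card {xy : ZMod p × ZMod p //
          xy.2 ^ 2 = xy.1 ^ 3 + AB.1 * xy.1 + AB.2} : ℤ)) ^ 2 =
      ((p : ℤ) ^ 2 - 1) * ((p : ℤ) - 1) := by
  have hp : p.Prime := Fact.out
  have hF : ringChar (ZMod p) ≠ 2 := by
    rw [ZMod.ringChar_zmod_n]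
    omega
  have h2 : (2 : ZMod p) ≠ 0 := by
    have h := (ZMod.natCast_eq_zero_iff 2 p).not.mpr (Nat.not_dvd_of_pos_of_lt two_pos (by omega))
    exact_mod_cast h
  have h3 : (3 : ZMod p) ≠ 0 := by
    have h := (ZMod.natCast_eq_zero_iff 3 p).not.mpr (Nat.not_dvd_of_pos_of_lt three_pos (by omega))
    exact_mod_cast h
  have ha (AB : ZMod p × ZMod p) : ((p : ℤ) - (Nat.card {xy : ZMod p × ZMod p //
      xy.2 ^ 2 = xy.1 ^ 3 + AB.1 * xy.1 + AB.2} : ℤ)) ^ 2 =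
      (∑ x, quadraticChar (ZMod p) (x ^ 3 + AB.1 * x + AB.2)) ^ 2 := by
    rw [natCard_sq_eq_eq_sum_quadraticChar hF fun x => x ^ 3 + AB.1 * x + AB.2, ZMod.card]
    ring
  simp_rw [ha]
  have htotal := sum_sq_sum_quadraticChar_cubic hF
  rw [← Finset.sum_filter_add_sum_filter_not _
      (fun AB : ZMod p × ZMod p => 4 * AB.1 ^ 3 + 27 * AB.2 ^ 2 ≠ 0),
    sum_singular_cubic h2 h3] at htotal
  simp_rw [sq_sum_quadraticChar_singular_cubic hF h3] at htotal
  rw [← Finset.sum_erase_add _ _ (Finset.mem_univ (0 : ZMod p)),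
    Finset.sum_congr rfl fun c hc => if_neg (Finset.ne_of_mem_erase hc)] at htotal
  simp only [Finset.sum_const, Finset.card_erase_of_mem (Finset.mem_univ _), Finset.card_univ,
    ZMod.card, nsmul_eq_mul, Nat.cast_sub hp.one_le, if_true] at htotal
  push_cast at htotal
  linear_combination htotal
end

section
/- For every prime p ≥ 5, the sum of a_p(A,B)⁶ over all pairs (A,B) ∈ (ℤ/pℤ)² with 4A³ + 27B² ≠ 0 equals (5p⁴ - 9p² - 5p - 1)(p - 1). (Equivalently, since there are exactly p² - p such pairs, the sixth moment of a_p is 5p³ - 9p - 5 - p⁻¹; this is Birch's formula M₆(a_p) = 5p³ - 9p - 5 - p⁻¹.) -/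
open Finset

section FiniteFieldSums

theorem sum_ite_ne_zero {F : Type*} [Fintype F] [DecidableEq F] (a : F) (c : ℤ) :
    ∑ x : F, (if x = a then 0 else c) = ((Fintype.card F : ℤ) - 1) * c := by
  have h : ∀ x : F, (if x = a then 0 else c) = c - if x = a then c else 0 := by
    intro x; split_ifs <;> simp
  simp only [h, sum_sub_distrib, sum_ite_eq', mem_univ, if_true, sum_const, card_univ,
    nsmul_eq_mul]
  ring

theorem sum_comp_mul_add {F M : Type*} [Field F] [Fintype F] [AddCommMonoid M]
    {a : F} (ha : a ≠ 0) (b : F) (G : F → M) :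
    ∑ x, G (a * x + b) = ∑ x, G x := by
  refine Fintype.sum_bijective (fun x => a * x + b) ⟨?_, fun y => ⟨a⁻¹ * (y - b), ?_⟩⟩ _ _
    fun _ => rfl
  · intro x y h
    simpa [ha] using h
  · simp only
    rw [mul_inv_cancel_left₀ ha]; ring

theorem sum_fin_succ_pi {F M : Type*} [Fintype F] [DecidableEq F] [AddCommMonoid M]
    {n : ℕ} (G : (Fin (n + 1) → F) → M) :
    ∑ v, G v = ∑ a, ∑ w : Fin n → F, G (Fin.cons a w) := by
  rw [← Fintype.sum_prod_type']
  exact (Fintype.sum_equiv (Fin.consEquiv fun _ => F) _ _ fun _ => rfl).symm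

variable {F : Type*} [Field F] [Fintype F] [DecidableEq F]

local notation "χ" => quadraticChar F
local notation "q" => (Fintype.card F : ℤ)

theorem quadraticChar_mul_sq {a : F} (ha : a ≠ 0) (b : F) : χ (a ^ 2 * b) = χ b := by
  rw [map_mul, quadraticChar_sq_one' ha, one_mul]

theorem quadraticChar_pow_three (a : F) : χ a ^ 3 = χ a := by
  rcases eq_or_ne a 0 with rfl | ha
  · simp
  · rw [pow_succ, quadraticChar_sq_one ha, one_mul]

theorem quadraticChar_pow_six {a : F} (ha : a ≠ 0) : χ a ^ 6 = 1 := by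
  rw [show 6 = 2 * 3 from rfl, pow_mul, quadraticChar_sq_one ha, one_pow]

theorem sum_quadraticChar_sq : ∑ x : F, χ x ^ 2 = q - 1 := by
  rw [← mul_one (q - 1), ← sum_ite_ne_zero (0 : F)]
  refine sum_congr rfl fun x _ => ?_
  split_ifs with h
  · simp [h]
  · exact quadraticChar_sq_one h

theorem sum_quadraticChar_mul_add (h2 : ringChar F ≠ 2) {a : F} (ha : a ≠ 0) (b : F) :
    ∑ x, χ (a * x + b) = 0 := by
  rw [sum_comp_mul_add ha b (fun x => χ x), quadraticChar_sum_zero h2]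

theorem sum_quadraticChar_add (h2 : ringChar F ≠ 2) (b : F) :
    ∑ x, χ (x + b) = 0 := by
  simpa using sum_quadraticChar_mul_add h2 one_ne_zero b

theorem sum_comp_sq (h2 : ringChar F ≠ 2) (G : F → ℤ) :
    ∑ x, G (x ^ 2) = ∑ y, (1 + χ y) * G y := by
  rw [← sum_fiberwise_of_maps_to (s := univ) (t := univ) (g := fun x : F => x ^ 2)
    (fun _ _ => mem_univ _)]
  refine sum_congr rfl fun y _ => ?_
  rw [sum_congr rfl (g := fun _ => G y) (fun x hx => by rw [(mem_filter.1 hx).2]), sum_const,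
    nsmul_eq_mul, add_comm (1 : ℤ), ← quadraticChar_card_sqrts h2]
  congr 3
  ext x
  simp

theorem sum_quadraticChar_mul_quadraticChar_add (h2 : ringChar F ≠ 2) (s : F) :
    ∑ w, χ w * χ (s + w) = (if s = 0 then q else 0) - 1 := by
  split_ifs with hs
  · subst hs
    simp only [zero_add, ← sq]
    exact sum_quadraticChar_sq
  · have h : ∀ w : F, χ w * χ (s + w) = χ (s * w⁻¹ + 1) - if w = 0 then 1 else 0 := by
      intro w
      split_ifs with hw
      · simp [hw]
      · rw [← map_mul, show w * (s + w) = w ^ 2 * (s * w⁻¹ + 1) by field_simp,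
          quadraticChar_mul_sq hw, sub_zero]
    simp only [h, sum_sub_distrib, sum_ite_eq', mem_univ, if_true]
    rw [Fintype.sum_equiv (Equiv.inv F) (fun w => χ (s * w⁻¹ + 1)) (fun w => χ (s * w + 1))
      (fun _ => rfl), sum_quadraticChar_mul_add h2 hs]

theorem sum_quadraticChar_sq_add (h2 : ringChar F ≠ 2) (s : F) :
    ∑ x, χ (x ^ 2 + s) = (if s = 0 then q else 0) - 1 := by
  rw [sum_comp_sq h2 (fun y => χ (y + s))]
  simp only [add_mul, one_mul, sum_add_distrib]
  rw [sum_quadraticChar_add h2, zero_add, ← sum_quadraticChar_mul_quadraticChar_add h2]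
  simp only [add_comm s]

theorem sum_quadraticChar_add_pow_two (h2 : ringChar F ≠ 2) (s : ℤ) :
    ∑ a, (χ a + s) ^ 2 = q * s ^ 2 + (q - 1) := by
  have h : ∀ a : F, (χ a + s) ^ 2 = s ^ 2 + χ a ^ 2 + 2 * s * χ a := fun a => by ring
  simp only [h, sum_add_distrib, ← mul_sum, quadraticChar_sum_zero h2, sum_quadraticChar_sq]
  simp

theorem sum_quadraticChar_add_pow_four (h2 : ringChar F ≠ 2) (s : ℤ) :
    ∑ a, (χ a + s) ^ 4 = q * s ^ 4 + (q - 1) * (6 * s ^ 2 + 1) := by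
  have h : ∀ a : F, (χ a + s) ^ 4 =
      s ^ 4 + (6 * s ^ 2 + 1) * χ a ^ 2 + (4 * s ^ 3 + 4 * s) * χ a := fun a => by
    linear_combination (χ a + 4 * s) * quadraticChar_pow_three a
  simp only [h, sum_add_distrib, ← mul_sum, quadraticChar_sum_zero h2, sum_quadraticChar_sq]
  simp
  ring

theorem sum_quadraticChar_add_pow_six (h2 : ringChar F ≠ 2) (s : ℤ) :
    ∑ a, (χ a + s) ^ 6 = q * s ^ 6 + (q - 1) * (15 * s ^ 4 + 15 * s ^ 2 + 1) := by
  have h : ∀ a : F, (χ a + s) ^ 6 = s ^ 6 + (15 * s ^ 4 + 15 * s ^ 2 + 1) * χ a ^ 2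
      + (6 * s ^ 5 + 20 * s ^ 3 + 6 * s) * χ a := fun a => by
    linear_combination (χ a ^ 3 + 6 * s * χ a ^ 2 + (15 * s ^ 2 + 1) * χ a + 20 * s ^ 3 + 6 * s)
      * quadraticChar_pow_three a
  simp only [h, sum_add_distrib, ← mul_sum, quadraticChar_sum_zero h2, sum_quadraticChar_sq]
  simp
  ring

/-! ### Sixth moment of a sum of independent values of the quadratic character -/

theorem moment_two (h2 : ringChar F ≠ 2) (n : ℕ) :
    q * ∑ v : Fin n → F, (∑ i, χ (v i)) ^ 2 = q ^ n * (n * (q - 1)) := by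
  induction n with
  | zero => simp
  | succ n ih =>
    rw [sum_fin_succ_pi, sum_comm]
    simp only [Fin.sum_univ_succ, Fin.cons_zero, Fin.cons_succ,
      sum_quadraticChar_add_pow_two h2, sum_add_distrib, ← mul_sum]
    simp [-quadraticChar_apply]
    linear_combination q * ih

theorem moment_four (h2 : ringChar F ≠ 2) (n : ℕ) :
    q ^ 2 * ∑ v : Fin n → F, (∑ i, χ (v i)) ^ 4 =
      q ^ n * (3 * n * (n - 1) * (q - 1) ^ 2 + n * q * (q - 1)) := by
  induction n with
  | zero => simp
  | succ n ih =>
    rw [sum_fin_succ_pi, sum_comm]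
    simp only [Fin.sum_univ_succ, Fin.cons_zero, Fin.cons_succ,
      sum_quadraticChar_add_pow_four h2, sum_add_distrib, ← mul_sum]
    simp [-quadraticChar_apply]
    linear_combination q * ih + 6 * q * (q - 1) * moment_two h2 n

theorem moment_six (h2 : ringChar F ≠ 2) (n : ℕ) :
    q ^ 3 * ∑ v : Fin n → F, (∑ i, χ (v i)) ^ 6 =
      q ^ n * (15 * n * (n - 1) * (n - 2) * (q - 1) ^ 3 + 15 * n * (n - 1) * q * (q - 1) ^ 2
        + n * q ^ 2 * (q - 1)) := by
  induction n with
  | zero => simp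
  | succ n ih =>
    rw [sum_fin_succ_pi, sum_comm]
    simp only [Fin.sum_univ_succ, Fin.cons_zero, Fin.cons_succ,
      sum_quadraticChar_add_pow_six h2, sum_add_distrib, ← mul_sum]
    simp [-quadraticChar_apply]
    linear_combination q * ih + 15 * q * (q - 1) * moment_four h2 n
      + 15 * q ^ 2 * (q - 1) * moment_two h2 n

end FiniteFieldSums

section QuarticForms

variable {F : Type*} [Field F]

/-- The value at `P` of the binary quartic form with coefficients `f`. -/
def quarticForm (f : Fin 5 → F) (P : F × F) : F :=
  f 0 * P.1 ^ 4 + f 1 * P.1 ^ 3 * P.2 + f 2 * P.1 ^ 2 * P.2 ^ 2 + f 3 * P.1 * P.2 ^ 3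
    + f 4 * P.2 ^ 4

/-- The determinant of two vectors of the plane. -/
def planeDet (P Q : F × F) : F := P.1 * Q.2 - P.2 * Q.1

/-- Homogeneous coordinates for the points of the projective line, `none` being at infinity. -/
def projPoint : Option F → F × F
  | none => (1, 0)
  | some x => (x, 1)

theorem planeDet_self (P : F × F) : planeDet P P = 0 := by
  unfold planeDet; ring

theorem planeDet_swap (P Q : F × F) : planeDet P Q = -planeDet Q P := by
  unfold planeDet; ring

theorem planeDet_projPoint_ne_zero {x y : Option F} (h : x ≠ y) :
    planeDet (projPoint x) (projPoint y) ≠ 0 := by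
  rcases x with _ | x <;> rcases y with _ | y
  · exact absurd rfl h
  · simp [planeDet, projPoint]
  · simp [planeDet, projPoint]
  · simpa [planeDet, projPoint, sub_eq_zero] using h

theorem quarticForm_sum_smul (v : Fin 5 → F) (g : Fin 5 → Fin 5 → F) (P : F × F) :
    quarticForm (∑ i, v i • g i) P = ∑ i, v i * quarticForm (g i) P := by
  simp only [quarticForm, Finset.sum_apply, Pi.smul_apply, smul_eq_mul, Finset.sum_mul,
    ← Finset.sum_add_distrib]
  exact sum_congr rfl fun i _ => by ring

theorem exists_quarticForm_eq_prod (c : F) (Q : Fin 4 → F × F) :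
    ∃ g : Fin 5 → F, ∀ P, quarticForm g P = c * ∏ j, planeDet P (Q j) := by
  refine ⟨![c * ((Q 0).2 * (Q 1).2 * (Q 2).2 * (Q 3).2),
    -c * ((Q 0).1 * (Q 1).2 * (Q 2).2 * (Q 3).2 + (Q 0).2 * (Q 1).1 * (Q 2).2 * (Q 3).2
      + (Q 0).2 * (Q 1).2 * (Q 2).1 * (Q 3).2 + (Q 0).2 * (Q 1).2 * (Q 2).2 * (Q 3).1),
    c * ((Q 0).1 * (Q 1).1 * (Q 2).2 * (Q 3).2 + (Q 0).1 * (Q 1).2 * (Q 2).1 * (Q 3).2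
      + (Q 0).1 * (Q 1).2 * (Q 2).2 * (Q 3).1 + (Q 0).2 * (Q 1).1 * (Q 2).1 * (Q 3).2
      + (Q 0).2 * (Q 1).1 * (Q 2).2 * (Q 3).1 + (Q 0).2 * (Q 1).2 * (Q 2).1 * (Q 3).1),
    -c * ((Q 0).2 * (Q 1).1 * (Q 2).1 * (Q 3).1 + (Q 0).1 * (Q 1).2 * (Q 2).1 * (Q 3).1
      + (Q 0).1 * (Q 1).1 * (Q 2).2 * (Q 3).1 + (Q 0).1 * (Q 1).1 * (Q 2).1 * (Q 3).2),
    c * ((Q 0).1 * (Q 1).1 * (Q 2).1 * (Q 3).1)], fun P => ?_⟩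
  simp only [quarticForm, planeDet, Fin.prod_univ_four, Matrix.cons_val]
  ring

/-- The value at `P` of the quartic form that is `1` at `Q i` and vanishes at the other four
points of `Q`. -/
def lagrangeValue (Q : Fin 5 → F × F) (P : F × F) (i : Fin 5) : F :=
  (∏ j, planeDet (Q i) (Q (i.succAbove j)))⁻¹ * ∏ j, planeDet P (Q (i.succAbove j))

theorem lagrangeValue_apply {Q : Fin 5 → F × F}
    (hQ : ∀ i j, i ≠ j → planeDet (Q i) (Q j) ≠ 0) (i k : Fin 5) :
    lagrangeValue Q (Q k) i = if i = k then 1 else 0 := by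
  unfold lagrangeValue
  split_ifs with h
  · subst h
    exact inv_mul_cancel₀ (prod_ne_zero_iff.2 fun j _ => hQ _ _ (i.succAbove_ne j).symm)
  · obtain ⟨j, hj⟩ := Fin.exists_succAbove_eq (Ne.symm h)
    exact mul_eq_zero_of_right _ (prod_eq_zero (mem_univ j) (by rw [hj, planeDet_self]))

theorem exists_interpolation_equiv [Finite F] {Q : Fin 5 → F × F}
    (hQ : ∀ i j, i ≠ j → planeDet (Q i) (Q j) ≠ 0) :
    ∃ e : (Fin 5 → F) ≃ (Fin 5 → F), (∀ v i, quarticForm (e v) (Q i) = v i) ∧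
      ∀ v P, quarticForm (e v) P = ∑ i, v i * lagrangeValue Q P i := by
  choose g hg using fun i => exists_quarticForm_eq_prod
    (∏ j, planeDet (Q i) (Q (i.succAbove j)))⁻¹ fun j => Q (i.succAbove j)
  have h1 : ∀ (v : Fin 5 → F) P,
      quarticForm (∑ i, v i • g i) P = ∑ i, v i * lagrangeValue Q P i := by
    intro v P
    rw [quarticForm_sum_smul]
    exact sum_congr rfl fun i _ => by rw [hg, lagrangeValue]
  have h2 : ∀ (v : Fin 5 → F) k, quarticForm (∑ i, v i • g i) (Q k) = v k := by
    intro v k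
    simp [h1, lagrangeValue_apply hQ]
  have hinj : Function.Injective fun v : Fin 5 → F => ∑ i, v i • g i := by
    intro v w h
    ext k
    rw [← h2 v k, ← h2 w k]
    exact congrArg (quarticForm · (Q k)) h
  exact ⟨Equiv.ofBijective _ (Finite.injective_iff_bijective.1 hinj), h2, h1⟩

theorem lagrangeValue_ne_zero {Q : Fin 5 → F × F}
    (hQ : ∀ i j, i ≠ j → planeDet (Q i) (Q j) ≠ 0) {P : F × F}
    (hP : ∀ i, planeDet P (Q i) ≠ 0) (i : Fin 5) : lagrangeValue Q P i ≠ 0 :=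
  mul_ne_zero (inv_ne_zero (prod_ne_zero_iff.2 fun _ _ => hQ _ _ (i.succAbove_ne _).symm))
    (prod_ne_zero_iff.2 fun _ _ => hP _)

theorem prod_lagrangeValue_isSquare (Q : Fin 5 → F × F) (P : F × F) :
    IsSquare (∏ i, lagrangeValue Q P i) := by
  unfold lagrangeValue
  rw [prod_mul_distrib]
  refine IsSquare.mul ?_ ?_
  · rw [prod_inv_distrib, isSquare_inv]
    refine ⟨planeDet (Q 0) (Q 1) * planeDet (Q 0) (Q 2) * planeDet (Q 0) (Q 3)
      * planeDet (Q 0) (Q 4) * planeDet (Q 1) (Q 2) * planeDet (Q 1) (Q 3)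
      * planeDet (Q 1) (Q 4) * planeDet (Q 2) (Q 3) * planeDet (Q 2) (Q 4)
      * planeDet (Q 3) (Q 4), ?_⟩
    simp only [Fin.prod_univ_five, Fin.prod_univ_four]
    simp only [Fin.succAbove, Fin.isValue, Fin.reduceLT, Fin.reduceCastSucc, Fin.reduceSucc,
      if_true, if_false]
    rw [planeDet_swap (Q 1) (Q 0), planeDet_swap (Q 2) (Q 0), planeDet_swap (Q 3) (Q 0),
      planeDet_swap (Q 4) (Q 0), planeDet_swap (Q 2) (Q 1), planeDet_swap (Q 3) (Q 1),
      planeDet_swap (Q 4) (Q 1), planeDet_swap (Q 3) (Q 2), planeDet_swap (Q 4) (Q 2),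
      planeDet_swap (Q 4) (Q 3)]
    ring
  · refine ⟨(∏ i, planeDet P (Q i)) ^ 2, ?_⟩
    simp only [Fin.prod_univ_five, Fin.prod_univ_four]
    simp only [Fin.succAbove, Fin.isValue, Fin.reduceLT, Fin.reduceCastSucc, Fin.reduceSucc,
      if_true, if_false]
    ring

end QuarticForms

section SumOverForms

theorem card_mul_sum_comp {V W : Type*} [AddGroup V] [AddGroup W] [Fintype V] [Fintype W]
    [DecidableEq W] (f : V →+ W) (hf : Function.Surjective f) (G : W → ℤ) :
    Fintype.card W * ∑ v, G (f v) = Fintype.card V * ∑ w, G w := by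
  have hfib : ∀ w : W, #{v | f v = w} = #{v | f v = 0} := fun w =>
    AddMonoidHom.card_fiber_eq_of_mem_range f (hf w) (hf 0)
  have h : ∀ H : W → ℤ, ∑ v, H (f v) = #{v | f v = 0} * ∑ w, H w := by
    intro H
    rw [← sum_fiberwise_of_maps_to (s := univ) (t := univ) (g := f) (fun _ _ => mem_univ _),
      mul_sum]
    refine sum_congr rfl fun w _ => ?_
    rw [sum_congr rfl (g := fun _ => H w) (fun x hx => by rw [(mem_filter.1 hx).2]), sum_const,
      nsmul_eq_mul, hfib]
  have h1 := h fun _ => 1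
  simp only [sum_const, card_univ, nsmul_eq_mul, mul_one] at h1
  rw [h G, h1]
  ring

variable {F : Type*} [Field F] [Fintype F] [DecidableEq F]

local notation "χ" => quadraticChar F
local notation "q" => (Fintype.card F : ℤ)

theorem sum_pi_quadraticChar_succ (n : ℕ) (s : F) :
    ∑ w : Fin (n + 1) → F, (∏ i, χ (w i)) * χ (s + ∑ i, w i) =
      ∑ a, χ a * ∑ w : Fin n → F, (∏ i, χ (w i)) * χ (s + a + ∑ i, w i) := by
  rw [sum_fin_succ_pi]
  simp only [Fin.prod_univ_succ, Fin.sum_univ_succ, Fin.cons_zero, Fin.cons_succ, mul_sum,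
    add_assoc, mul_assoc]

theorem sum_pi_quadraticChar_two (h2 : ringChar F ≠ 2) (s : F) :
    ∑ a, χ a * ∑ b, χ b * χ (s + a + b) = q * χ (-1) * χ s := by
  have h : ∀ a, (s + a = 0) = (a = -s) := fun a => by
    rw [add_comm, add_eq_zero_iff_eq_neg]
  simp only [sum_quadraticChar_mul_quadraticChar_add h2, h, mul_sub, sum_sub_distrib, mul_one,
    quadraticChar_sum_zero h2, mul_ite, mul_zero, sum_ite_eq', mem_univ, if_true, sub_zero]
  rw [neg_eq_neg_one_mul s, map_mul]
  ring

theorem sum_pi_quadraticChar_five (h2 : ringChar F ≠ 2) :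
    ∑ w : Fin 5 → F, (∏ i, χ (w i)) * χ (∑ i, w i) = q ^ 2 * (q - 1) := by
  have h := sum_pi_quadraticChar_succ (F := F) 4 0
  simp only [zero_add] at h
  rw [h]
  simp only [sum_pi_quadraticChar_succ]
  simp only [univ_unique, prod_of_isEmpty, sum_of_isEmpty, sum_singleton, one_mul, add_zero]
  simp only [sum_pi_quadraticChar_two h2]
  have h1 : χ (-1) ^ 2 = 1 := quadraticChar_sq_one (neg_ne_zero.2 one_ne_zero)
  have h3 : ∀ a : F, ∑ b, χ b * ∑ c, χ c * (q * χ (-1) * χ (a + b + c)) = q ^ 2 * χ a := by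
    intro a
    calc _ = q * χ (-1) * ∑ b, χ b * ∑ c, χ c * χ (a + b + c) := by
          simp only [mul_sum]
          exact sum_congr rfl fun b _ => sum_congr rfl fun c _ => by ring
      _ = _ := by
          rw [sum_pi_quadraticChar_two h2]
          linear_combination q ^ 2 * χ a * h1
  simp only [h3]
  rw [← sum_quadraticChar_sq, mul_sum]
  exact sum_congr rfl fun a _ => by ring

theorem sum_pi_quadraticChar_linear (h2 : ringChar F ≠ 2) {l : Fin 5 → F} (hl : ∀ i, l i ≠ 0)
    (hsq : IsSquare (∏ i, l i)) :
    ∑ v : Fin 5 → F, (∏ i, χ (v i)) * χ (∑ i, v i * l i) = q ^ 2 * (q - 1) := by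
  rw [← sum_pi_quadraticChar_five h2]
  refine Fintype.sum_equiv (Equiv.piCongrRight fun i => Equiv.mulRight₀ (l i) (hl i)) _ _
    fun v => ?_
  have h1 : ∏ i, χ (l i) = 1 := by
    rw [← map_prod]
    exact (quadraticChar_one_iff_isSquare (prod_ne_zero_iff.2 fun i _ => hl i)).2 hsq
  simp only [Equiv.piCongrRight_apply, Pi.map_apply, Equiv.mulRight₀_apply, map_mul,
    prod_mul_distrib, h1, mul_one]

theorem sum_prod_quarticForm_of_injective (h2 : ringChar F ≠ 2) {P : Fin 6 → Option F}
    (hP : Function.Injective P) :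
    ∑ f : Fin 5 → F, ∏ i, χ (quarticForm f (projPoint (P i))) = q ^ 2 * (q - 1) := by
  have hQ : ∀ i j : Fin 5, i ≠ j → planeDet (projPoint (P i.castSucc))
      (projPoint (P j.castSucc)) ≠ 0 := fun i j hij =>
    planeDet_projPoint_ne_zero fun h => hij (Fin.castSucc_injective _ (hP h))
  have hL : ∀ i : Fin 5, planeDet (projPoint (P (Fin.last 5)))
      (projPoint (P i.castSucc)) ≠ 0 := fun i =>
    planeDet_projPoint_ne_zero fun h => (Fin.castSucc_lt_last i).ne' (hP h)
  obtain ⟨e, he, he'⟩ := exists_interpolation_equiv hQ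
  rw [← Equiv.sum_comp e, ← sum_pi_quadraticChar_linear h2 (lagrangeValue_ne_zero hQ hL)
    (prod_lagrangeValue_isSquare _ _)]
  refine sum_congr rfl fun v _ => ?_
  rw [Fin.prod_univ_castSucc, he']
  simp only [he]

theorem sum_prod_quarticForm_of_not_injective (h5 : 5 ≤ Fintype.card F) {P : Fin 6 → Option F}
    (hP : ¬ Function.Injective P) :
    q ^ (Fintype.card F + 1) * ∑ f : Fin 5 → F, ∏ i, χ (quarticForm f (projPoint (P i))) =
      q ^ 5 * ∑ v : Option F → F, ∏ i, χ (v (P i)) := by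
  have hcard : #(univ.image P) ≤ 5 := by
    have h : #(univ.image P) ≤ 6 := card_image_le
    have h' : #(univ.image P) ≠ 6 := fun h => hP fun x y hxy =>
      (card_image_iff (s := univ).1 h) (mem_coe.2 (mem_univ x)) (mem_coe.2 (mem_univ y)) hxy
    omega
  obtain ⟨T, hT, hT5⟩ := exists_superset_card_eq hcard (n := 5) (by simp; omega)
  let Q : Fin 5 → Option F := fun i => (T.equivFinOfCardEq hT5).symm i
  have hQinj : Function.Injective Q :=
    Subtype.val_injective.comp (T.equivFinOfCardEq hT5).symm.injective
  have hσ : ∀ i, ∃ j, Q j = P i := fun i =>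
    ⟨T.equivFinOfCardEq hT5 ⟨P i, hT (mem_image_of_mem P (mem_univ i))⟩, by simp [Q]⟩
  choose σ hσ using hσ
  obtain ⟨e, he, -⟩ := exists_interpolation_equiv (Q := fun i => projPoint (Q i)) fun i j hij =>
    planeDet_projPoint_ne_zero (hQinj.ne hij)
  let r : (Option F → F) →+ (Fin 5 → F) :=
    { toFun := fun v => v ∘ Q, map_zero' := rfl, map_add' := fun _ _ => rfl }
  have hr : Function.Surjective r := hQinj.surjective_comp_right
  have key := card_mul_sum_comp r hr fun w => ∏ i, χ (w (σ i))
  have hrv : ∀ v : Option F → F, ∏ i, χ (r v (σ i)) = ∏ i, χ (v (P i)) := fun v =>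
    prod_congr rfl fun i _ => by rw [← hσ]; rfl
  simp only [hrv, Fintype.card_fun, Fintype.card_fin, Fintype.card_option, Nat.cast_pow] at key
  rw [key, ← Equiv.sum_comp e]
  simp only [← hσ, he]

theorem sum_prod_of_injective (h2 : ringChar F ≠ 2) {P : Fin 6 → Option F}
    (hP : Function.Injective P) : ∑ v : Option F → F, ∏ i, χ (v (P i)) = 0 := by
  let r : (Option F → F) →+ (Fin 6 → F) :=
    { toFun := fun v => v ∘ P, map_zero' := rfl, map_add' := fun _ _ => rfl }
  have key := card_mul_sum_comp r hP.surjective_comp_right fun w => ∏ i, χ (w i)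
  have h0 : ∑ w : Fin 6 → F, ∏ i, χ (w i) = 0 := by
    rw [← Fintype.prod_sum, prod_eq_zero (mem_univ 0) (quadraticChar_sum_zero h2)]
  rw [h0, mul_zero, mul_eq_zero] at key
  exact key.resolve_left (Nat.cast_ne_zero.2 Fintype.card_ne_zero)

theorem sum_quarticForm_moment_six (h2 : ringChar F ≠ 2) (h5 : 5 ≤ Fintype.card F) :
    ∑ f : Fin 5 → F, (∑ x, χ (quarticForm f (projPoint x))) ^ 6 =
      q ^ 2 * (q + 1) * (q - 1) * (15 * q * (q - 1) ^ 3 + 15 * q ^ 2 * (q - 1) + q ^ 2 +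
        q * (q - 1) * (q - 2) * (q - 3) * (q - 4)) := by
  classical
  have hq : q ≠ 0 := by positivity
  have hinj : ∀ P : Fin 6 → Option F,
      q ^ (Fintype.card F + 1) * ∑ f : Fin 5 → F, ∏ i, χ (quarticForm f (projPoint (P i))) =
        q ^ 5 * ∑ v : Option F → F, ∏ i, χ (v (P i)) +
          if Function.Injective P then q ^ (Fintype.card F + 1) * (q ^ 2 * (q - 1)) else 0 := by
    intro P
    split_ifs with hP
    · rw [sum_prod_quarticForm_of_injective h2 hP, sum_prod_of_injective h2 hP]
      ring
    · rw [sum_prod_quarticForm_of_not_injective h5 hP, add_zero]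
  have hcount : (#{P : Fin 6 → Option F | Function.Injective P} : ℤ) =
      (q + 1) * q * (q - 1) * (q - 2) * (q - 3) * (q - 4) := by
    rw [← Fintype.card_subtype, Fintype.card_congr (Equiv.subtypeInjectiveEquivEmbedding _ _),
      Fintype.card_embedding_eq, Fintype.card_option, Fintype.card_fin]
    obtain ⟨m, hm⟩ := Nat.exists_eq_add_of_le h5
    rw [hm, show 5 + m + 1 = m + 6 by ring]
    simp only [Nat.descFactorial_succ, Nat.descFactorial_zero]
    rw [show m + 6 - 5 = m + 1 by omega, show m + 6 - 4 = m + 2 by omega,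
      show m + 6 - 3 = m + 3 by omega, show m + 6 - 2 = m + 4 by omega,
      show m + 6 - 1 = m + 5 by omega, Nat.sub_zero]
    push_cast
    ring
  have hmoment : q ^ 3 * ∑ v : Option F → F, (∑ x, χ (v x)) ^ 6 = q ^ (Fintype.card F + 1) *
      ((q + 1) * (15 * q * (q - 1) * (q - 1) ^ 3 + 15 * q * q * (q - 1) ^ 2
        + q ^ 2 * (q - 1))) := by
    have e : Option F ≃ Fin (Fintype.card F + 1) := Fintype.equivFinOfCardEq Fintype.card_option
    rw [Fintype.sum_equiv (Equiv.arrowCongr e (Equiv.refl F)) _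
      (fun v => (∑ i, χ (v i)) ^ 6) fun v => by
        rw [Fintype.sum_equiv e _ (fun i => χ (v (e.symm i))) fun x => by simp]; rfl,
      moment_six h2]
    push_cast
    ring
  have hexp : q ^ (Fintype.card F + 1) *
      ∑ f : Fin 5 → F, (∑ x, χ (quarticForm f (projPoint x))) ^ 6 =
        q ^ 5 * ∑ v : Option F → F, (∑ x, χ (v x)) ^ 6 + q ^ (Fintype.card F + 1) *
          (q ^ 2 * (q - 1) * ((q + 1) * q * (q - 1) * (q - 2) * (q - 3) * (q - 4))) := by
    simp only [Fintype.sum_pow]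
    rw [sum_comm, mul_sum, sum_congr rfl fun P _ => hinj P, sum_add_distrib, ← mul_sum, sum_comm,
      ← sum_filter, sum_const, nsmul_eq_mul, hcount]
    ring
  refine mul_left_cancel₀ (pow_ne_zero (Fintype.card F + 1) hq) ?_
  rw [hexp]
  linear_combination q ^ 2 * hmoment

end SumOverForms

section CubicSums

theorem sum_eq_sum_of_affine {F : Type*} [Field F] [Fintype F] {a : F} (ha : a ≠ 0)
    (b : F) {G H : F → ℤ}
    (h : ∀ x, G x = H (a * x + b)) : ∑ x, G x = ∑ x, H x := by
  simp only [h, sum_comp_mul_add ha b H]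

theorem sum_depress {F : Type*} [Field F] [Fintype F] (k : F) (l : F → F) (G : F → F → ℤ) :
    ∑ c, ∑ d, G (c - k) (d + l c) = ∑ A, ∑ B, G A B := by
  have h : ∀ c, ∑ d, G (c - k) (d + l c) = ∑ B, G (1 * c + -k) B := fun c => by
    simpa [sub_eq_add_neg] using sum_comp_mul_add one_ne_zero (l c) (G (c - k))
  simp only [h]
  exact sum_comp_mul_add one_ne_zero (-k) fun A => ∑ B, G A B

theorem pow_six_eq_of_eq_mul {c s t : ℤ} (hc : c ^ 6 = 1) (h : s = c * t) : s ^ 6 = t ^ 6 := by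
  rw [h, mul_pow, hc, one_mul]

variable {F : Type*} [Field F] [Fintype F] [DecidableEq F]

local notation "χ" => quadraticChar F
local notation "q" => (Fintype.card F : ℤ)

/-- The character sum of a polynomial of degree at most three. -/
def cubicSum (a b c d : F) : ℤ := ∑ x, χ (a * x ^ 3 + b * x ^ 2 + c * x + d)

/-- The sum of the sixth powers of the character sums of all depressed monic cubics. -/
def cubicMoment (F : Type*) [Field F] [Fintype F] [DecidableEq F] : ℤ :=
  ∑ A : F, ∑ B : F, cubicSum 1 0 A B ^ 6

theorem sum_eq_zero_add_of_const {G : F → ℤ} {C : ℤ} (h : ∀ a, a ≠ 0 → G a = C) :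
    ∑ a, G a = G 0 + (q - 1) * C := by
  rw [← sum_ite_ne_zero (0 : F), ← add_sum_erase _ _ (mem_univ (0 : F)),
    ← add_sum_erase _ (fun x : F => if x = 0 then 0 else C) (mem_univ (0 : F)), if_pos rfl,
    zero_add]
  congr 1
  refine sum_congr rfl fun a ha => ?_
  rw [h a (ne_of_mem_erase ha), if_neg (ne_of_mem_erase ha)]

theorem sum_quadraticChar_pow_six : ∑ a, χ a ^ 6 = q - 1 := by
  rw [sum_eq_zero_add_of_const (C := 1) fun a ha => quadraticChar_pow_six ha]
  simp

theorem cubicSum_scale {a : F} (ha : a ≠ 0) (b c d : F) :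
    cubicSum a b c d = χ a * cubicSum 1 (a⁻¹ * b) (a⁻¹ * c) (a⁻¹ * d) := by
  simp only [cubicSum, mul_sum, ← map_mul]
  refine sum_congr rfl fun x _ => congrArg _ ?_
  field_simp

theorem cubicSum_depress (h3 : (3 : F) ≠ 0) (b c d : F) :
    cubicSum 1 b c d =
      cubicSum 1 0 (c - b ^ 2 / 3) (d + (2 * b ^ 3 / 27 - b * c / 3)) := by
  have h27 : (27 : F) ≠ 0 := by
    rw [show (27 : F) = 3 ^ 3 by norm_num]; exact pow_ne_zero 3 h3
  unfold cubicSum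
  rw [← sum_comp_mul_add one_ne_zero (-(b / 3))
    (fun x => χ (1 * x ^ 3 + b * x ^ 2 + c * x + d))]
  refine sum_congr rfl fun x _ => congrArg _ ?_
  field_simp
  ring

theorem sum_monic_cubicSum_pow_six (h3 : (3 : F) ≠ 0) (b : F) :
    ∑ c, ∑ d, cubicSum 1 b c d ^ 6 = cubicMoment F := by
  refine Eq.trans ?_ (sum_depress (b ^ 2 / 3) (fun c => 2 * b ^ 3 / 27 - b * c / 3)
    fun A B => cubicSum 1 0 A B ^ 6)
  exact sum_congr rfl fun c _ => sum_congr rfl fun d _ => by rw [cubicSum_depress h3]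

theorem cubicSum_twist {n : F} (hn : n ≠ 0) (A B : F) :
    cubicSum 1 0 (n ^ 2 * A) (n ^ 3 * B) = χ n * cubicSum 1 0 A B := by
  unfold cubicSum
  rw [← sum_comp_mul_add hn 0 (fun x => χ (1 * x ^ 3 + 0 * x ^ 2 + n ^ 2 * A * x + n ^ 3 * B)),
    mul_sum]
  refine sum_congr rfl fun x _ => ?_
  rw [← map_mul, ← quadraticChar_mul_sq hn (n * _)]
  exact congrArg _ (by ring)

theorem sum_cubicSum_pow_seven (h2 : ringChar F ≠ 2) :
    ∑ A : F, ∑ B : F, cubicSum 1 0 A B ^ 7 = 0 := by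
  obtain ⟨n, hn⟩ := quadraticChar_exists_neg_one h2
  have hn0 : n ≠ 0 := fun h => by simp [h] at hn
  have h : ∑ A : F, ∑ B : F, cubicSum 1 0 A B ^ 7 =
      ∑ A : F, ∑ B : F, -cubicSum 1 0 A B ^ 7 := by
    rw [← sum_comp_mul_add (pow_ne_zero 2 hn0) 0]
    refine sum_congr rfl fun A _ => ?_
    rw [← sum_comp_mul_add (pow_ne_zero 3 hn0) 0]
    refine sum_congr rfl fun B _ => ?_
    rw [add_zero, add_zero, cubicSum_twist hn0, hn]
    ring
  simp only [sum_neg_distrib] at h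
  linarith

theorem sum_weighted_cubicSum_pow_six (h2 : ringChar F ≠ 2) (h3 : (3 : F) ≠ 0) :
    ∑ b : F, ∑ c, ∑ d, (1 + χ (d - b * c)) * cubicSum 1 b c d ^ 6 = q * cubicMoment F := by
  have h27 : (27 : F) ≠ 0 := by
    rw [show (27 : F) = 3 ^ 3 by norm_num]; exact pow_ne_zero 3 h3
  have h : ∀ b : F, ∑ c, ∑ d, (1 + χ (d - b * c)) * cubicSum 1 b c d ^ 6 =
      ∑ A, ∑ B, (1 + χ (1 * (-2 / 3 * b + 0) ^ 3 + 0 * (-2 / 3 * b + 0) ^ 2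
        + A * (-2 / 3 * b + 0) + B)) * cubicSum 1 0 A B ^ 6 := by
    intro b
    refine Eq.trans ?_ (sum_depress (b ^ 2 / 3) (fun c => 2 * b ^ 3 / 27 - b * c / 3)
      fun A B => (1 + χ (1 * (-2 / 3 * b + 0) ^ 3 + 0 * (-2 / 3 * b + 0) ^ 2
        + A * (-2 / 3 * b + 0) + B)) * cubicSum 1 0 A B ^ 6)
    refine sum_congr rfl fun c _ => sum_congr rfl fun d _ => ?_
    rw [← cubicSum_depress h3]
    congr 3
    field_simp
    ring
  have h23 : (-2 / 3 : F) ≠ 0 :=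
    div_ne_zero (neg_ne_zero.2 (Ring.two_ne_zero h2)) h3
  simp only [h]
  rw [sum_comp_mul_add h23 0 fun x => ∑ A, ∑ B, (1 + χ (1 * x ^ 3 + 0 * x ^ 2 + A * x + B))
    * cubicSum 1 0 A B ^ 6, sum_comm]
  have h' : ∀ A : F, ∑ x, ∑ B, (1 + χ (1 * x ^ 3 + 0 * x ^ 2 + A * x + B)) * cubicSum 1 0 A B ^ 6
      = ∑ B, (q * cubicSum 1 0 A B ^ 6 + cubicSum 1 0 A B ^ 7) := by
    intro A
    rw [sum_comm]
    refine sum_congr rfl fun B _ => ?_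
    rw [← sum_mul, sum_add_distrib]
    simp only [sum_const, card_univ, nsmul_eq_mul, mul_one]
    rw [← cubicSum]
    ring
  simp only [h', sum_add_distrib, sum_cubicSum_pow_seven h2, ← mul_sum, add_zero]
  rfl

theorem sum_ite_sq_eq (h2 : ringChar F ≠ 2) {a : F} (ha : a ≠ 0) (b k : F) :
    ∑ x, (if (a * x + b) ^ 2 = k then 1 else 0) = 1 + χ k := by
  rw [sum_comp_mul_add ha b fun x => if x ^ 2 = k then (1 : ℤ) else 0,
    sum_comp_sq h2 fun y => if y = k then (1 : ℤ) else 0]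
  simp

theorem sum_quadraticChar_double_root (h2 : ringChar F ≠ 2) (r t : F) :
    ∑ x, χ ((x - r) ^ 2 * (x - t)) = -χ (r - t) := by
  have h : ∀ x, χ ((x - r) ^ 2 * (x - t)) = χ (x + -t) - if x = r then χ (r - t) else 0 := by
    intro x
    split_ifs with hx
    · simp [hx, sub_eq_add_neg]
    · rw [quadraticChar_mul_sq (sub_ne_zero.2 hx), sub_zero, sub_eq_add_neg]
  simp only [h, sum_sub_distrib, sum_quadraticChar_add h2, sum_ite_eq', mem_univ, if_true, zero_sub]

/-! ### Monic quartics and their resolvent cubics -/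

theorem sum_quadraticChar_quartic (h2 : ringChar F ≠ 2) {c d e : F}
    (h : d ≠ 0 ∨ 4 * e ≠ c ^ 2) :
    1 + ∑ x, χ (x ^ 4 + c * x ^ 2 + d * x + e) =
      cubicSum 1 c (-4 * e) (d ^ 2 - 4 * c * e) := by
  have two : (2 : F) ≠ 0 := Ring.two_ne_zero h2
  have four : (4 : F) ≠ 0 := by
    rw [show (4 : F) = 2 ^ 2 by norm_num]; exact pow_ne_zero 2 two
  have hx : ∀ x : F, ∑ u, (if 4 * (u + c) * x ^ 2 + 4 * d * x = u ^ 2 - 4 * e then (1 : ℤ) else 0)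
      = 1 + χ (x ^ 4 + c * x ^ 2 + d * x + e) := by
    intro x
    rw [← quadraticChar_mul_sq two (x ^ 4 + c * x ^ 2 + d * x + e),
      ← sum_ite_sq_eq h2 one_ne_zero (-2 * x ^ 2)]
    refine sum_congr rfl fun u _ => if_congr ⟨fun h => ?_, fun h => ?_⟩ rfl rfl
    · linear_combination -h
    · linear_combination -h
  have hu : ∀ u : F, ∑ x, (if 4 * (u + c) * x ^ 2 + 4 * d * x = u ^ 2 - 4 * e then (1 : ℤ) else 0)
      = 1 + χ (1 * u ^ 3 + c * u ^ 2 + -4 * e * u + (d ^ 2 - 4 * c * e))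
        - if u = -c then 1 else 0 := by
    intro u
    split_ifs with huc
    · subst huc
      rw [show 1 * (-c) ^ 3 + c * (-c) ^ 2 + -4 * e * -c + (d ^ 2 - 4 * c * e) = d ^ 2 by ring]
      rcases eq_or_ne d 0 with rfl | hd
      · have he : ∀ x : F, ¬ (4 * (-c + c) * x ^ 2 + 4 * 0 * x = (-c) ^ 2 - 4 * e) := by
          intro x hx
          refine (h.resolve_left (not_not_intro rfl)) ?_
          linear_combination hx
        simp only [he, if_false, sum_const_zero]
        simp
      · have he : ∀ x : F, (4 * (-c + c) * x ^ 2 + 4 * d * x = (-c) ^ 2 - 4 * e) ↔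
            x = (c ^ 2 - 4 * e) / (4 * d) := by
          intro x
          rw [eq_div_iff (mul_ne_zero four hd)]
          constructor <;> intro hx <;> linear_combination hx
        simp only [he, sum_ite_eq', mem_univ, if_true, quadraticChar_sq_one' hd]
        norm_num
    · have huc' : u + c ≠ 0 := fun h => huc (eq_neg_of_add_eq_zero_left h)
      rw [sub_zero, ← sum_ite_sq_eq h2 (mul_ne_zero two huc') d]
      refine sum_congr rfl fun x _ => if_congr ⟨fun h => ?_, fun h => ?_⟩ rfl rfl
      · linear_combination (u + c) * h
      · refine mul_left_cancel₀ huc' ?_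
        linear_combination h
  have key := sum_comm (s := univ) (t := univ) (f := fun x u : F =>
    if 4 * (u + c) * x ^ 2 + 4 * d * x = u ^ 2 - 4 * e then (1 : ℤ) else 0)
  simp only [hx, hu, sum_add_distrib, sum_sub_distrib, sum_ite_eq', mem_univ, if_true] at key
  unfold cubicSum
  linarith

theorem sum_quadraticChar_sq_quadratic (h2 : ringChar F ≠ 2) (m : F) :
    1 + ∑ x, χ ((x ^ 2 + m) ^ 2) = q - χ (-m) := by
  have h : ∀ y : F, (1 + χ y) * χ ((y + m) ^ 2) =
      1 + χ y - if y = -m then 1 + χ y else 0 := by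
    intro y
    split_ifs with hy
    · simp [hy]
    · rw [quadraticChar_sq_one' fun h => hy (eq_neg_of_add_eq_zero_left h)]
      ring
  rw [sum_comp_sq h2 fun y => χ ((y + m) ^ 2)]
  simp only [h, sum_add_distrib, sum_sub_distrib, sum_ite_eq', mem_univ, if_true,
    quadraticChar_sum_zero h2, sum_const, card_univ, nsmul_eq_mul]
  ring

theorem sum_resolvent_pow_six (h2 : ringChar F ≠ 2) (h3 : (3 : F) ≠ 0) :
    ∑ c : F, ∑ d, ∑ e, cubicSum 1 c (-4 * e) (d ^ 2 - 4 * c * e) ^ 6 = q * cubicMoment F := by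
  have four : (-4 : F) ≠ 0 := by
    rw [show (-4 : F) = -2 ^ 2 by norm_num]
    exact neg_ne_zero.2 (pow_ne_zero 2 (Ring.two_ne_zero h2))
  rw [← sum_weighted_cubicSum_pow_six h2 h3]
  refine sum_congr rfl fun c _ => ?_
  rw [sum_comm]
  refine sum_eq_sum_of_affine four 0 fun e => ?_
  rw [sum_comp_sq h2 fun y => cubicSum 1 c (-4 * e) (y - 4 * c * e) ^ 6]
  refine sum_eq_sum_of_affine one_ne_zero (-4 * c * e) fun y => ?_
  rw [add_zero, show 1 * y + -4 * c * e - c * (-4 * e) = y by ring,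
    show 1 * y + -4 * c * e = y - 4 * c * e by ring]

theorem sum_depressed_quartic_pow_six (h2 : ringChar F ≠ 2) (h3 : (3 : F) ≠ 0) :
    ∑ c : F, ∑ d, ∑ e, (1 + ∑ x, χ (x ^ 4 + c * x ^ 2 + d * x + e)) ^ 6 =
      q * cubicMoment F + q ^ 7 + (q - 1) * (15 * q ^ 4 + 15 * q ^ 2) := by
  have two : (2 : F) ≠ 0 := Ring.two_ne_zero h2
  have four : (4 : F) ≠ 0 := by
    rw [show (4 : F) = 2 ^ 2 by norm_num]; exact pow_ne_zero 2 two
  have hdiff : ∀ c : F, ∑ d, ∑ e, ((1 + ∑ x, χ (x ^ 4 + c * x ^ 2 + d * x + e)) ^ 6 -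
      cubicSum 1 c (-4 * e) (d ^ 2 - 4 * c * e) ^ 6) =
        (χ (-(2⁻¹ : F) * c + 0) + -q) ^ 6 - χ (-2 * c + 0) ^ 6 := by
    intro c
    rw [Fintype.sum_eq_single 0, Fintype.sum_eq_single (c ^ 2 / 4)]
    · have h1 : ∀ x : F, x ^ 4 + c * x ^ 2 + 0 * x + c ^ 2 / 4 = (x ^ 2 + 2⁻¹ * c) ^ 2 := by
        intro x
        rw [show (4 : F) = 2 ^ 2 by norm_num]
        field_simp
        ring
      have h4 : cubicSum 1 c (-4 * (c ^ 2 / 4)) (0 ^ 2 - 4 * c * (c ^ 2 / 4)) = -χ (-2 * c) := by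
        rw [show -2 * c = -c - c by ring, ← sum_quadraticChar_double_root h2]
        refine sum_congr rfl fun x _ => congrArg _ ?_
        field_simp
        ring
      rw [h4]
      simp only [h1, sum_quadraticChar_sq_quadratic h2, add_zero, neg_mul]
      ring
    · intro e he
      rw [sum_quadraticChar_quartic h2 (Or.inr fun h => he ?_), sub_self]
      rw [← h]
      field_simp
    · intro d hd
      refine sum_eq_zero fun e _ => ?_
      rw [sum_quadraticChar_quartic h2 (Or.inl hd), sub_self]
  have hsum := sum_congr rfl fun (c : F) (_ : c ∈ univ) => hdiff c
  simp only [sum_sub_distrib, sum_resolvent_pow_six h2 h3] at hsum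
  rw [sum_comp_mul_add (neg_ne_zero.2 (inv_ne_zero two)) 0 fun x => (χ x + -q) ^ 6,
    sum_comp_mul_add (neg_ne_zero.2 two) 0 fun x => χ x ^ 6,
    sum_quadraticChar_add_pow_six h2, sum_quadraticChar_pow_six] at hsum
  linear_combination hsum

theorem sum_monic_quartic_pow_six (h2 : ringChar F ≠ 2) (h3 : (3 : F) ≠ 0) (b : F) :
    ∑ c, ∑ d, ∑ e, (1 + ∑ x, χ (x ^ 4 + b * x ^ 3 + c * x ^ 2 + d * x + e)) ^ 6 =
      q * cubicMoment F + q ^ 7 + (q - 1) * (15 * q ^ 4 + 15 * q ^ 2) := by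
  have four : (4 : F) ≠ 0 := by
    rw [show (4 : F) = 2 ^ 2 by norm_num]; exact pow_ne_zero 2 (Ring.two_ne_zero h2)
  obtain ⟨t, rfl⟩ : ∃ t, b = 4 * t := ⟨b / 4, by field_simp⟩
  rw [← sum_depressed_quartic_pow_six h2 h3]
  refine sum_eq_sum_of_affine one_ne_zero (-(6 * t ^ 2)) fun c => ?_
  refine sum_eq_sum_of_affine one_ne_zero (8 * t ^ 3 - 2 * t * c) fun d => ?_
  refine sum_eq_sum_of_affine one_ne_zero (t ^ 2 * c - t * d - 3 * t ^ 4) fun e => ?_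
  congr 2
  refine sum_eq_sum_of_affine one_ne_zero t fun x => congrArg _ ?_
  ring

theorem sum_quartic_pow_six (h2 : ringChar F ≠ 2) (h3 : (3 : F) ≠ 0) {a : F} (ha : a ≠ 0) :
    ∑ b : F, ∑ c, ∑ d, ∑ e,
      (χ a + ∑ x, χ (a * x ^ 4 + (b * x ^ 3 + c * x ^ 2 + d * x + e))) ^ 6 =
      q * (q * cubicMoment F + q ^ 7 + (q - 1) * (15 * q ^ 4 + 15 * q ^ 2)) := by
  have h := sum_congr rfl fun (b : F) (_ : b ∈ univ) => sum_monic_quartic_pow_six h2 h3 b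
  rw [sum_const, card_univ, nsmul_eq_mul] at h
  rw [← h]
  refine sum_eq_sum_of_affine (inv_ne_zero ha) 0 fun b => ?_
  refine sum_eq_sum_of_affine (inv_ne_zero ha) 0 fun c => ?_
  refine sum_eq_sum_of_affine (inv_ne_zero ha) 0 fun d => ?_
  refine sum_eq_sum_of_affine (inv_ne_zero ha) 0 fun e => ?_
  refine pow_six_eq_of_eq_mul (quadraticChar_pow_six ha) ?_
  rw [mul_add, mul_one, mul_sum]
  congr 1
  refine sum_congr rfl fun x _ => ?_
  rw [← map_mul]
  congr 1
  field_simp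
  ring

theorem sum_cubic_pow_six (h3 : (3 : F) ≠ 0) {a : F} (ha : a ≠ 0) :
    ∑ b : F, ∑ c, ∑ d, cubicSum a b c d ^ 6 = q * cubicMoment F := by
  have h := sum_congr rfl fun (b : F) (_ : b ∈ univ) => sum_monic_cubicSum_pow_six h3 b
  rw [sum_const, card_univ, nsmul_eq_mul] at h
  rw [← h]
  refine sum_eq_sum_of_affine (inv_ne_zero ha) 0 fun b => ?_
  refine sum_eq_sum_of_affine (inv_ne_zero ha) 0 fun c => ?_
  refine sum_eq_sum_of_affine (inv_ne_zero ha) 0 fun d => ?_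
  rw [cubicSum_scale ha, mul_pow, quadraticChar_pow_six ha, one_mul, add_zero, add_zero, add_zero]

theorem sum_quadratic_pow_six (h2 : ringChar F ≠ 2) :
    ∑ b : F, ∑ c, ∑ d, cubicSum 0 b c d ^ 6 =
      (q - 1) * (q * (q - 1) + q * (q - 1) ^ 6 + q ^ 6) := by
  have two : (2 : F) ≠ 0 := Ring.two_ne_zero h2
  have hb : ∀ b : F, b ≠ 0 → ∑ c, ∑ d, cubicSum 0 b c d ^ 6 =
      q * ((q - 1) ^ 6 + (q - 1)) := by
    intro b hb
    have hc : ∀ c, ∑ d, cubicSum 0 b c d ^ 6 = (q - 1) ^ 6 + (q - 1) := by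
      intro c
      have hm : ∑ m : F, (∑ x, χ (x ^ 2 + m)) ^ 6 = (q - 1) ^ 6 + (q - 1) * 1 := by
        simp only [sum_quadraticChar_sq_add h2]
        rw [sum_eq_zero_add_of_const (C := 1) fun a ha => by simp [ha]]
        simp
      rw [mul_one] at hm
      rw [← hm]
      refine sum_eq_sum_of_affine (inv_ne_zero hb) (-(c / (2 * b)) ^ 2) fun d => ?_
      refine pow_six_eq_of_eq_mul (quadraticChar_pow_six hb) ?_
      rw [mul_sum, cubicSum]
      refine sum_eq_sum_of_affine one_ne_zero (c / (2 * b)) fun x => ?_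
      rw [← map_mul]
      congr 1
      field_simp
      ring
    simp only [hc, sum_const, card_univ, nsmul_eq_mul]
  have hc : ∀ c : F, c ≠ 0 → ∑ d, cubicSum 0 0 c d ^ 6 = 0 := by
    intro c hc
    refine sum_eq_zero fun d _ => ?_
    have : cubicSum 0 0 c d = ∑ x, χ (c * x + d) := by simp [cubicSum]
    rw [this, sum_quadraticChar_mul_add h2 hc]
    rfl
  have hd : ∑ d : F, cubicSum 0 0 0 d ^ 6 = q ^ 6 * (q - 1) := by
    rw [← sum_quadraticChar_pow_six, mul_sum]
    refine sum_congr rfl fun d _ => ?_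
    simp [cubicSum, -quadraticChar_apply, mul_pow]
  rw [sum_eq_zero_add_of_const hb, sum_eq_zero_add_of_const hc, hd]
  ring

theorem cubicMoment_eq (h2 : ringChar F ≠ 2) (h3 : (3 : F) ≠ 0) (h5 : 5 ≤ Fintype.card F) :
    cubicMoment F = q * (q - 1) * (5 * q ^ 3 - 9 * q - 5) := by
  have hS := sum_quarticForm_moment_six h2 h5
  have hform : ∀ a b c d e : F,
      ∑ x, χ (quarticForm (Fin.cons a (Fin.cons b (Fin.cons c (Fin.cons d (Fin.cons e
        (default : Fin 0 → F)))))) (projPoint x)) =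
      χ a + ∑ x, χ (a * x ^ 4 + (b * x ^ 3 + c * x ^ 2 + d * x + e)) := by
    intro a b c d e
    rw [Fintype.sum_option]
    congr 1
    · simp [quarticForm, projPoint]
    · refine sum_congr rfl fun x _ => congrArg _ ?_
      change a * x ^ 4 + b * x ^ 3 * 1 + c * x ^ 2 * 1 ^ 2 + d * x * 1 ^ 3 + e * 1 ^ 4 = _
      ring
  simp only [sum_fin_succ_pi] at hS
  simp only [univ_unique, sum_singleton, hform] at hS
  rw [sum_eq_zero_add_of_const fun a ha => sum_quartic_pow_six h2 h3 ha] at hS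
  simp only [quadraticChar_zero, zero_add, zero_mul, ← cubicSum.eq_1] at hS
  rw [sum_eq_zero_add_of_const fun a ha => sum_cubic_pow_six h3 ha, sum_quadratic_pow_six h2] at hS
  have hq : (q - 1) * q * (q + 1) ≠ 0 := by
    have : (5 : ℤ) ≤ q := by exact_mod_cast h5
    exact mul_ne_zero (mul_ne_zero (by omega) (by omega)) (by omega)
  refine mul_left_cancel₀ hq ?_
  linear_combination hS

theorem sum_singular_pow_six (h2 : ringChar F ≠ 2) (h3 : (3 : F) ≠ 0) :
    ∑ AB : F × F with ¬ 4 * AB.1 ^ 3 + 27 * AB.2 ^ 2 ≠ 0, cubicSum 1 0 AB.1 AB.2 ^ 6 = q - 1 := by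
  have two : (2 : F) ≠ 0 := Ring.two_ne_zero h2
  rw [← sum_quadraticChar_pow_six, ← sum_comp_mul_add h3 0]
  symm
  refine sum_nbij' (fun r => (-3 * r ^ 2, 2 * r ^ 3)) (fun AB => -3 * AB.2 / (2 * AB.1))
    (fun r _ => ?_) (fun _ _ => mem_univ _) (fun r _ => ?_) (fun AB h => ?_) (fun r _ => ?_)
  · rw [mem_filter]
    exact ⟨mem_univ _, not_not_intro (by ring)⟩
  · rcases eq_or_ne r 0 with rfl | hr
    · simp
    · field_simp
  · obtain ⟨A, B⟩ := AB
    have hAB : 4 * A ^ 3 + 27 * B ^ 2 = 0 := not_not.1 (mem_filter.1 h).2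
    rcases eq_or_ne A 0 with rfl | hA
    · have hB : B = 0 := by
        have h27 : (3 : F) ^ 3 * B ^ 2 = 0 := by linear_combination hAB
        simpa [h3] using h27
      simp [hB]
    · ext
      · simp only
        field_simp
        linear_combination -hAB
      · simp only
        field_simp
        linear_combination -B * hAB
  · have h : cubicSum 1 0 (-3 * r ^ 2) (2 * r ^ 3) = -χ (3 * r + 0) := by
      rw [show 3 * r + 0 = r - -2 * r by ring, ← sum_quadraticChar_double_root h2]
      exact sum_congr rfl fun x _ => congrArg _ (by ring)
    rw [h]
    ring

theorem card_points_eq (h2 : ringChar F ≠ 2) (A B : F) :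
    (Nat.card {xy : F × F // xy.2 ^ 2 = xy.1 ^ 3 + A * xy.1 + B} : ℤ) =
      q + cubicSum 1 0 A B := by
  rw [Nat.card_eq_fintype_card, Fintype.card_subtype, card_filter, Fintype.sum_prod_type]
  have h : ∀ x : F, ∑ y : F, (if y ^ 2 = x ^ 3 + A * x + B then (1 : ℤ) else 0) =
      1 + χ (1 * x ^ 3 + 0 * x ^ 2 + A * x + B) := by
    intro x
    rw [one_mul, zero_mul, add_zero, ← sum_ite_sq_eq h2 one_ne_zero 0]
    simp only [one_mul, add_zero]
  push_cast
  simp only [h, sum_add_distrib, sum_const, card_univ, nsmul_eq_mul, mul_one]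
  rfl

theorem sum_trace_pow_six (h2 : ringChar F ≠ 2) (h3 : (3 : F) ≠ 0) (h5 : 5 ≤ Fintype.card F) :
    ∑ AB : F × F with 4 * AB.1 ^ 3 + 27 * AB.2 ^ 2 ≠ 0,
      (q - (Nat.card {xy : F × F // xy.2 ^ 2 = xy.1 ^ 3 + AB.1 * xy.1 + AB.2} : ℤ)) ^ 6 =
      (5 * q ^ 4 - 9 * q ^ 2 - 5 * q - 1) * (q - 1) := by
  have h := cubicMoment_eq h2 h3 h5
  rw [cubicMoment, ← Fintype.sum_prod_type' fun A B : F => cubicSum 1 0 A B ^ 6,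
    ← sum_filter_add_sum_filter_not univ fun AB : F × F => 4 * AB.1 ^ 3 + 27 * AB.2 ^ 2 ≠ 0,
    sum_singular_pow_six h2 h3] at h
  have h' : ∀ AB : F × F,
      (q - (Nat.card {xy : F × F // xy.2 ^ 2 = xy.1 ^ 3 + AB.1 * xy.1 + AB.2} : ℤ)) ^ 6 =
        cubicSum 1 0 AB.1 AB.2 ^ 6 := by
    intro AB
    rw [card_points_eq h2]
    ring
  simp only [h']
  linear_combination h

end CubicSums


/-- **Birch's formula** `M₆(a_p) = 5p³ - 9p - 5 - p⁻¹` for a prime `p ≥ 5`: the sum of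
`a_p(A,B)^6` over all pairs `(A,B) ∈ (ℤ/pℤ)²` with `4A³ + 27B² ≠ 0` equals
`5 * (p : ℤ) ^ 4 - 9 * (p : ℤ) ^ 2 - 5 * (p : ℤ) - 1`, where `a_p(A,B) = p - #{(x,y) : y² = x³ + Ax + B}`. -/
theorem birch_sixth_moment (p : ℕ) [Fact p.Prime] (hp5 : 5 ≤ p) :
    ∑ AB ∈ Finset.univ.filter
        (fun AB : ZMod p × ZMod p => 4 * AB.1 ^ 3 + 27 * AB.2 ^ 2 ≠ 0),
      ((p : ℤ) -
        (Nat.card {xy : ZMod p × ZMod p //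
          xy.2 ^ 2 = xy.1 ^ 3 + AB.1 * xy.1 + AB.2} : ℤ)) ^ 6 =
      (5 * (p : ℤ) ^ 4 - 9 * (p : ℤ) ^ 2 - 5 * (p : ℤ) - 1) * ((p : ℤ) - 1) := by
  have h2 : ringChar (ZMod p) ≠ 2 := by
    rw [ZMod.ringChar_zmod_n]
    omega
  have h3 : (3 : ZMod p) ≠ 0 := by
    intro h
    have h' : ((3 : ℕ) : ZMod p) = 0 := by exact_mod_cast h
    have := Nat.le_of_dvd (by norm_num) ((ZMod.natCast_eq_zero_iff 3 p).1 h')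
    omega
  have key := sum_trace_pow_six h2 h3 (by rwa [ZMod.card])
  rw [ZMod.card] at key
  exact key
end
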